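/- arXiv:2206.00331 — 2 statements merged into one kernel-verified Lean document; each statement's English description precedes it below -/
import Mathlib

section
/- Let (E, L, τ) be an isodual Euclidean lattice whose associated bilinear form b_τ is symmetric or alternating, and let 0 = E₀ ⊊ E₁ ⊊ ⋯ ⊊ E_ℓ = E be a GS-flag of (E, L). Then: (1) τ(Eᵢ) = (E_{ℓ−i})^⊥ for every 0 ≤ i ≤ ℓ, where ⊥ denotes the orthogonal complement in E; (2) Eᵢ is totally isotropic with respect to b_τ (i.e. b_τ(x, y) = 0 for all x, y ∈ Eᵢ) whenever 2i ≤ ℓ, and co-isotropic (i.e. every x ∈ E with b_τ(x, Eᵢ) = 0 lies in Eᵢ) whenever 2i ≥ ℓ. -/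
open Module

noncomputable section

namespace EucLat

variable {E : Type*} [NormedAddCommGroup E] [InnerProductSpace ℝ E]

/-- The covolume of a `ℤ`-submodule of a real inner product space: the square root of the
Gram determinant of a `ℤ`-basis (junk value `0` if no finite basis exists). -/
def covol (L : Submodule ℤ E) : ℝ :=
  @dite _ (∃ n : ℕ, Nonempty (Basis (Fin n) ℤ L)) (Classical.propDecidable _)
    (fun h => Real.sqrt (Matrix.det (Matrix.of fun i j =>
      (inner ℝ ((h.choose_spec.some i : L) : E) ((h.choose_spec.some j : L) : E) : ℝ))))
    (fun _ => 0)

/-- The reduced height `covol(L)^(1/dim E)` of a full lattice. -/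
def redH (L : Submodule ℤ E) : ℝ := covol L ^ ((finrank ℝ E : ℝ)⁻¹)

/-- The lattice `L ∩ F` induced on a subspace `F`. -/
def latIn (L : Submodule ℤ E) (F : Submodule ℝ E) : Submodule ℤ F :=
  L.comap (F.subtype.restrictScalars ℤ)

/-- The reduced height of a subspace: `covol(F ∩ L)^(1/dim F)`. -/
def Hr (L : Submodule ℤ E) (F : Submodule ℝ E) : ℝ := redH (latIn L F)

/-- A subspace is rational if it is spanned by its intersection with the lattice. -/
def IsRational (L : Submodule ℤ E) (F : Submodule ℝ E) : Prop :=
  Submodule.span ℝ ((L : Set E) ∩ (F : Set E)) = F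

/-- `(E, L)` is a Euclidean lattice: `L` is discrete and spans `E` over `ℝ`. -/
def IsLat (L : Submodule ℤ E) : Prop :=
  DiscreteTopology L ∧ Submodule.span ℝ (L : Set E) = ⊤

/-- Minimal reduced height: infimum of reduced heights of nonzero rational subspaces. -/
def Hmin (L : Submodule ℤ E) : ℝ :=
  sInf {h : ℝ | ∃ F : Submodule ℝ E, F ≠ ⊥ ∧ IsRational L F ∧ h = Hr L F}

/-- Semistability of a Euclidean lattice. -/
def Semistable (L : Submodule ℤ E) : Prop :=
  ∀ F : Submodule ℝ E, F ≠ ⊥ → IsRational L F → redH L ≤ Hr L F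

/-- Stability of a Euclidean lattice. -/
def Stable (L : Submodule ℤ E) : Prop :=
  Semistable L ∧ ∀ F : Submodule ℝ E, F ≠ ⊥ → F ≠ ⊤ → IsRational L F → redH L < Hr L F

/-- The quotient lattice of `(E, L)` by a subspace `F`: the image of `L` under the
orthogonal projection of `E` onto `Fᗮ`. -/
def quotLat [FiniteDimensional ℝ E] (L : Submodule ℤ E) (F : Submodule ℝ E) :
    Submodule ℤ Fᗮ :=
  L.map ((Submodule.orthogonalProjectionOnto Fᗮ : E →ₗ[ℝ] Fᗮ).restrictScalars ℤ)

/-- For subspaces `F ≤ F'`, the successive quotient lattice: the image of `F' ∩ L` under the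
orthogonal projection of `F'` onto the orthogonal complement of `F` inside `F'`. -/
def succQuot [FiniteDimensional ℝ E] (L : Submodule ℤ E) (F F' : Submodule ℝ E) :
    Submodule ℤ ((F.comap F'.subtype)ᗮ) :=
  quotLat (latIn L F') (F.comap F'.subtype)

/-- A GS-flag of `(E, L)`. -/
def IsGSFlag [FiniteDimensional ℝ E] (L : Submodule ℤ E) {ℓ : ℕ}
    (C : Fin (ℓ + 1) → Submodule ℝ E) : Prop :=
  C 0 = ⊥ ∧ C (Fin.last ℓ) = ⊤ ∧
  (∀ i : Fin ℓ, C i.castSucc < C i.succ) ∧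
  (∀ i, IsRational L (C i)) ∧
  (∀ i : Fin ℓ, Semistable (succQuot L (C i.castSucc) (C i.succ))) ∧
  (∀ i j : Fin ℓ, i < j →
    redH (succQuot L (C i.castSucc) (C i.succ)) < redH (succQuot L (C j.castSucc) (C j.succ)))

/-- The dual lattice `L* = {y : ⟪x, y⟫ ∈ ℤ for all x ∈ L}`. -/
def dualLat (L : Submodule ℤ E) : Submodule ℤ E where
  carrier := {y | ∀ x ∈ L, ∃ n : ℤ, (inner ℝ x y : ℝ) = n}
  zero_mem' := fun x _ => ⟨0, by simp⟩
  add_mem' := by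
    intro a b ha hb x hx
    obtain ⟨m, hm⟩ := ha x hx
    obtain ⟨n, hn⟩ := hb x hx
    exact ⟨m + n, by rw [inner_add_right, hm, hn]; push_cast; ring⟩
  smul_mem' := by
    intro z y hy x hx
    obtain ⟨n, hn⟩ := hy x hx
    refine ⟨z * n, ?_⟩
    rw [← Int.cast_smul_eq_zsmul ℝ, real_inner_smul_right, hn]
    push_cast; ring

/-- `(E, L)` is isodual via the similarity `τ`. -/
def IsIsodual (L : Submodule ℤ E) (τ : E →ₗ[ℝ] E) : Prop :=
  (∃ α : ℝ, 0 < α ∧ ∀ x y : E, (inner ℝ (τ x) (τ y) : ℝ) = α * inner ℝ x y) ∧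
  L.map (τ.restrictScalars ℤ) = dualLat L

/-- The bilinear form `b_τ(x, y) = ⟪τ x, y⟫` associated with an isoduality. -/
def bform (τ : E →ₗ[ℝ] E) (x y : E) : ℝ := inner ℝ (τ x) y

/-- `b` has signature `s`: there is a `b`-orthogonal basis with `p - q = s`. -/
def HasSignature (b : E → E → ℝ) (s : ℤ) : Prop :=
  ∃ (n : ℕ) (v : Basis (Fin n) ℝ E),
    (∀ i j, i ≠ j → b (v i) (v j) = 0) ∧
    s = ((Finset.univ.filter fun i => 0 < b (v i) (v i)).card : ℤ) -
        ((Finset.univ.filter fun i => b (v i) (v i) < 0).card : ℤ)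

/-- The destabilizing subspace of `(E, L)`. -/
def IsDestabilizing (L : Submodule ℤ E) (F : Submodule ℝ E) : Prop :=
  F ≠ ⊥ ∧ IsRational L F ∧ Hr L F = Hmin L ∧
  ∀ F' : Submodule ℝ E, F' ≠ ⊥ → IsRational L F' → Hr L F' = Hmin L → F' ≤ F

/-- `(G, t)` is a realization of the tensor product of the inner product spaces `E` and `F`:
`t` induces a linear isomorphism `E ⊗ F ≃ G` and
`⟪t x y, t x' y'⟫ = ⟪x, x'⟫ * ⟪y, y'⟫` on pure tensors. -/
def IsTensor {F G : Type*} [NormedAddCommGroup F] [InnerProductSpace ℝ F]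
    [NormedAddCommGroup G] [InnerProductSpace ℝ G] (t : E →ₗ[ℝ] F →ₗ[ℝ] G) : Prop :=
  Function.Bijective (TensorProduct.lift t) ∧
  ∀ (x x' : E) (y y' : F),
    (inner ℝ (t x y) (t x' y') : ℝ) = (inner ℝ x x' : ℝ) * (inner ℝ y y' : ℝ)

/-- The tensor product lattice `L·M`: the additive subgroup generated by pure tensors. -/
def tensorLat {F G : Type*} [NormedAddCommGroup F] [InnerProductSpace ℝ F]
    [NormedAddCommGroup G] [InnerProductSpace ℝ G] (t : E →ₗ[ℝ] F →ₗ[ℝ] G)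
    (L : Submodule ℤ E) (M : Submodule ℤ F) : Submodule ℤ G :=
  Submodule.span ℤ (Set.image2 (fun x y => t x y) (L : Set E) (M : Set F))

/-- `g` is an automorphism of the Euclidean lattice `(E, L)`. -/
def IsAut (L : Submodule ℤ E) (g : E ≃ₗ[ℝ] E) : Prop :=
  (∀ x, x ∈ L ↔ g x ∈ L) ∧ ∀ x y : E, (inner ℝ (g x) (g y) : ℝ) = inner ℝ x y

/-- The direct product lattice `L × L'` inside `WithLp 2 (E × E')`. -/
def prodLat {E' : Type*} [NormedAddCommGroup E'] [InnerProductSpace ℝ E']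
    (L : Submodule ℤ E) (L' : Submodule ℤ E') : Submodule ℤ (WithLp 2 (E × E')) :=
  (L.prod L').comap (((WithLp.linearEquiv 2 ℝ (E × E')).restrictScalars ℤ) : WithLp 2 (E × E') →ₗ[ℤ] E × E')


section HN
variable {V : Type*} [AddCommGroup V] [Module ℝ V] [FiniteDimensional ℝ V]

/-- abstract data of a Harder–Narasimhan flag indexed by naturals -/
structure HN (R : Submodule ℝ V → Prop) (f : Submodule ℝ V → ℝ) (ℓ : ℕ)
    (C : ℕ → Submodule ℝ V) (μ : ℕ → ℝ) : Prop where
  inf : ∀ F G, R F → R G → R (F ⊓ G)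
  sup : ∀ F G, R F → R G → R (F ⊔ G)
  sub : ∀ F G, R F → R G → f (F ⊔ G) + f (F ⊓ G) ≤ f F + f G
  bot : C 0 = ⊥
  top : C ℓ = ⊤
  mono : ∀ i, i < ℓ → C i ≤ C (i + 1)
  rat : ∀ i, i ≤ ℓ → R (C i)
  ge : ∀ i, i < ℓ → ∀ G, R G → C i ≤ G → G ≤ C (i + 1) →
    μ i * ((finrank ℝ G : ℝ) - finrank ℝ (C i)) ≤ f G - f (C i)
  eq : ∀ i, i < ℓ →
    f (C (i + 1)) - f (C i) = μ i * ((finrank ℝ (C (i + 1)) : ℝ) - finrank ℝ (C i))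

variable {R : Submodule ℝ V → Prop} {f : Submodule ℝ V → ℝ} {ℓ : ℕ}
    {C : ℕ → Submodule ℝ V} {μ : ℕ → ℝ}

/-- the tilted degree -/
def gt (f : Submodule ℝ V → ℝ) (t : ℝ) (G : Submodule ℝ V) : ℝ := f G - t * finrank ℝ G

lemma HN.step (h : HN R f ℓ C μ) {G : Submodule ℝ V} (hG : R G) {i : ℕ} (hi : i < ℓ) :
    μ i * ((finrank ℝ ↥(G ⊓ C (i + 1)) : ℝ) - finrank ℝ ↥(G ⊓ C i)) ≤
      f (G ⊓ C (i + 1)) - f (G ⊓ C i) := by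
  have r1 := h.inf _ _ hG (h.rat (i + 1) hi)
  have r2 := h.rat i hi.le
  have hinf : G ⊓ C (i + 1) ⊓ C i = G ⊓ C i := by
    rw [inf_assoc, inf_eq_right.2 (h.mono i hi)]
  have s := h.sub _ _ r1 r2
  have g := h.ge i hi _ (h.sup _ _ r1 r2) le_sup_right (sup_le inf_le_right (h.mono i hi))
  have d := Submodule.finrank_sup_add_finrank_inf_eq (G ⊓ C (i + 1)) (C i)
  rw [hinf] at s d
  have d' : (finrank ℝ ↥(G ⊓ C (i + 1) ⊔ C i) : ℝ) + finrank ℝ ↥(G ⊓ C i) =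
    finrank ℝ ↥(G ⊓ C (i + 1)) + finrank ℝ ↥(C i) := by exact_mod_cast d
  have : (finrank ℝ ↥(G ⊓ C (i + 1) ⊔ C i) : ℝ) - finrank ℝ ↥(C i) =
    finrank ℝ ↥(G ⊓ C (i + 1)) - finrank ℝ ↥(G ⊓ C i) := by linarith
  rw [this] at g
  linarith

lemma HN.dim_le (h : HN R f ℓ C μ) (G : Submodule ℝ V) {i : ℕ} (hi : i < ℓ) :
    (finrank ℝ ↥(G ⊓ C i) : ℝ) ≤ finrank ℝ ↥(G ⊓ C (i + 1)) := by
  exact_mod_cast Submodule.finrank_mono (inf_le_inf_left _ (h.mono i hi))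

lemma HN.dim_le' (h : HN R f ℓ C μ) (G : Submodule ℝ V) {i : ℕ} (hi : i < ℓ) :
    (finrank ℝ ↥(G ⊓ C (i + 1)) : ℝ) - finrank ℝ ↥(G ⊓ C i) ≤
      finrank ℝ ↥(C (i + 1)) - finrank ℝ ↥(C i) := by
  have hinf : G ⊓ C (i + 1) ⊓ C i = G ⊓ C i := by
    rw [inf_assoc, inf_eq_right.2 (h.mono i hi)]
  have d := Submodule.finrank_sup_add_finrank_inf_eq (G ⊓ C (i + 1)) (C i)
  rw [hinf] at d
  have e := Submodule.finrank_mono (sup_le (inf_le_right : G ⊓ C (i + 1) ≤ _) (h.mono i hi))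
  have d' : (finrank ℝ ↥(G ⊓ C (i + 1) ⊔ C i) : ℝ) + finrank ℝ ↥(G ⊓ C i) =
    finrank ℝ ↥(G ⊓ C (i + 1)) + finrank ℝ ↥(C i) := by exact_mod_cast d
  have e' : (finrank ℝ ↥(G ⊓ C (i + 1) ⊔ C i) : ℝ) ≤ finrank ℝ ↥(C (i + 1)) := by
    exact_mod_cast e
  linarith

lemma HN.down (h : HN R f ℓ C μ) {G : Submodule ℝ V} (hG : R G) {t : ℝ} (i : ℕ) (hi : i ≤ ℓ)
    (ht : ∀ j < i, μ j ≤ t) :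
    gt f t (C i) ≤ gt f t (G ⊓ C i) ∧
      ((∀ j < i, μ j < t) → gt f t (G ⊓ C i) ≤ gt f t (C i) → G ⊓ C i = C i) := by
  induction i with
  | zero => rw [h.bot]; simp
  | succ i ih =>
    obtain ⟨a, b⟩ := ih (by omega) (fun j hj => ht j (by omega))
    have st := h.step hG (i := i) (by omega)
    have dd := h.dim_le' G (i := i) (by omega)
    have eq := h.eq i (by omega)
    have ti := ht i (by omega)
    have key := mul_le_mul_of_nonneg_left dd (sub_nonneg.2 ti)
    unfold gt at *
    constructor
    · linarith
    · intro hs hle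
      have hb := b (fun j hj => hs j (by omega)) (by linarith)
      rw [hb] at st dd key
      have : (finrank ℝ ↥(C (i + 1)) : ℝ) ≤ finrank ℝ ↥(G ⊓ C (i + 1)) := by
        have h1 := hs i (by omega)
        by_contra hcon
        push Not at hcon
        have := mul_pos (sub_pos.2 h1) (sub_pos.2 hcon)
        linarith
      exact Submodule.eq_of_le_of_finrank_le inf_le_right (by exact_mod_cast this)

lemma HN.up (h : HN R f ℓ C μ) {G : Submodule ℝ V} (hG : R G) {t : ℝ} (i k : ℕ) (hi : i + k ≤ ℓ)
    (ht : ∀ j, i ≤ j → j < ℓ → t ≤ μ j) :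
    gt f t (G ⊓ C i) ≤ gt f t (G ⊓ C (i + k)) ∧
      ((∀ j, i ≤ j → j < ℓ → t < μ j) → gt f t (G ⊓ C (i + k)) ≤ gt f t (G ⊓ C i) →
        G ⊓ C (i + k) = G ⊓ C i) := by
  induction k with
  | zero => simp
  | succ k ih =>
    obtain ⟨a, b⟩ := ih (by omega)
    rw [← add_assoc]
    have st := h.step hG (i := i + k) (by omega)
    have dd := h.dim_le G (i := i + k) (by omega)
    have ti := ht (i + k) (by omega) (by omega)
    have key := mul_nonneg (sub_nonneg.2 ti) (sub_nonneg.2 dd)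
    unfold gt at *
    constructor
    · linarith
    · intro hs hle
      have hb := b hs (by linarith)
      rw [hb] at st dd key
      have : (finrank ℝ ↥(G ⊓ C (i + k + 1)) : ℝ) ≤ finrank ℝ ↥(G ⊓ C i) := by
        have h1 := hs (i + k) (by omega) (by omega)
        by_contra hcon
        push Not at hcon
        have := mul_pos (sub_pos.2 h1) (sub_pos.2 hcon)
        linarith
      rw [← hb]
      rw [← hb] at this
      exact (Submodule.eq_of_le_of_finrank_le (inf_le_inf_left _ (h.mono _ (by omega)))
        (by exact_mod_cast this)).symm

lemma HN.min (h : HN R f ℓ C μ) {G : Submodule ℝ V} (hG : R G) {t : ℝ} (i : ℕ) (hi : i ≤ ℓ)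
    (ht : ∀ j < i, μ j ≤ t) (ht' : ∀ j, i ≤ j → j < ℓ → t ≤ μ j) :
    gt f t (C i) ≤ gt f t G := by
  obtain ⟨k, rfl⟩ := Nat.exists_eq_add_of_le hi
  have a := (h.down hG i hi ht).1
  have b := (h.up hG i k le_rfl ht').1
  rw [h.top, inf_top_eq] at b
  exact a.trans b

lemma HN.min_unique (h : HN R f ℓ C μ) {G : Submodule ℝ V} (hG : R G) {t : ℝ} (i : ℕ) (hi : i ≤ ℓ)
    (ht : ∀ j < i, μ j < t) (ht' : ∀ j, i ≤ j → j < ℓ → t < μ j)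
    (hle : gt f t G ≤ gt f t (C i)) : G = C i := by
  obtain ⟨k, rfl⟩ := Nat.exists_eq_add_of_le hi
  have a := h.down hG i hi (fun j hj => (ht j hj).le)
  have b := h.up hG i k le_rfl (fun j hj hj' => (ht' j hj hj').le)
  rw [h.top, inf_top_eq] at b
  rw [b.2 ht' (hle.trans a.1), a.2 ht (b.1.trans hle)]

lemma HN.exists_min (h : HN R f ℓ C μ) (hμ : ∀ i j, i < j → j < ℓ → μ i < μ j) (t : ℝ) :
    ∃ i ≤ ℓ, ∀ G, R G → gt f t (C i) ≤ gt f t G := by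
  by_cases hex : ∃ j, j < ℓ ∧ t ≤ μ j
  · classical
    obtain ⟨h1, h2⟩ := Nat.find_spec hex
    refine ⟨Nat.find hex, h1.le, fun G hG => h.min hG _ h1.le ?_ ?_⟩
    · intro j hj
      have := Nat.find_min hex hj
      push Not at this
      exact (this (hj.trans h1)).le
    · intro j hj hj'
      rcases hj.eq_or_lt with e | e
      · rw [← e]; exact h2
      · exact h2.trans (hμ _ _ e hj').le
  · push Not at hex
    exact ⟨ℓ, le_rfl, fun G hG => h.min hG _ le_rfl (fun j hj => (hex j hj).le)
      (fun j hj hj' => by omega)⟩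

lemma HN.exists_t (hμ : ∀ i j, i < j → j < ℓ → μ i < μ j) (i : ℕ) (hi : i ≤ ℓ) :
    ∃ t, (∀ j < i, μ j < t) ∧ (∀ j, i ≤ j → j < ℓ → t < μ j) := by
  obtain ⟨m, h1, h2⟩ := Order.exists_between_finsets ((Finset.range i).image μ)
    ((Finset.Ico i ℓ).image μ) (by
      simp only [Finset.mem_image, Finset.mem_range, Finset.mem_Ico]
      rintro _ ⟨a, ha, rfl⟩ _ ⟨b, hb, rfl⟩
      exact hμ _ _ (by omega) (by omega))
  refine ⟨m, fun j hj => h1 _ ?_, fun j hj hj' => h2 _ ?_⟩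
  · exact Finset.mem_image_of_mem _ (by simpa using hj)
  · exact Finset.mem_image_of_mem _ (by simp [hj, hj'])

/-- An antitone involution changing `f` by an affine function of the dimension reverses the flag. -/
lemma HN.dual (h : HN R f ℓ C μ) (hμ : ∀ i j, i < j → j < ℓ → μ i < μ j)
    (hC : ∀ i j, i < j → j ≤ ℓ → C i < C j)
    (σ : Submodule ℝ V → Submodule ℝ V) (hσR : ∀ G, R G → R (σ G))
    (hσσ : ∀ G, σ (σ G) = G) (hσ : ∀ F G, F ≤ G → σ G ≤ σ F)
    (hdim : ∀ G, finrank ℝ (σ G) + finrank ℝ G = finrank ℝ V)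
    (c d : ℝ) (hf : ∀ G, R G → f (σ G) = f G + c * finrank ℝ G + d) :
    ∀ i ≤ ℓ, σ (C i) = C (ℓ - i) := by
  have hex : ∀ i : Fin (ℓ + 1), ∃ j : Fin (ℓ + 1), σ (C i) = C j := by
    intro i
    obtain ⟨t, h1, h2⟩ := HN.exists_t hμ i (by omega)
    obtain ⟨j, hj, hmin⟩ := h.exists_min hμ (-c - t)
    have hg : ∀ G, R G → gt f (-c - t) G = gt f t (σ G) + (t * finrank ℝ V - d) := by
      intro G hG
      have e : (finrank ℝ (σ G) : ℝ) = finrank ℝ V - finrank ℝ G := by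
        rw [← hdim G]; push_cast; ring
      unfold gt
      rw [hf G hG, e]
      ring
    refine ⟨⟨j, by omega⟩, ?_⟩
    have hi := h.rat i (by omega)
    have := hmin _ (hσR _ hi)
    rw [hg _ (h.rat j hj), hg _ (hσR _ hi), hσσ] at this
    have := h.min_unique (hσR _ (h.rat j hj)) i (by omega) h1 h2 (by linarith)
    rw [← this, hσσ]
  choose s hs using hex
  have hC' : StrictMono (fun i : Fin (ℓ + 1) => C i) := fun a b hab => hC _ _ hab (by omega)
  have hanti : ∀ a b, a < b → s b < s a := by
    intro a b hab
    have h1 : C (s b) ≤ C (s a) := by rw [← hs, ← hs]; exact hσ _ _ (hC' hab).le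
    have h2 := hC'.le_iff_le.1 h1
    refine lt_of_le_of_ne h2 fun e => ?_
    have : σ (C a) = σ (C b) := by rw [hs, hs, e]
    have : C a = C b := by rw [← hσσ (C a), this, hσσ]
    exact (hC' hab).ne this
  have m1 : StrictMono (fun a => Fin.rev (s a)) := fun a b hab => Fin.rev_lt_rev.2 (hanti a b hab)
  have m2 : StrictMono (fun a => s (Fin.rev a)) := fun a b hab => hanti _ _ (Fin.rev_lt_rev.2 hab)
  intro i hi
  have a1 := m1.id_le ⟨i, by omega⟩
  have a2 := m2.id_le (Fin.rev ⟨i, by omega⟩)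
  rw [hs ⟨i, by omega⟩]
  congr 1
  simp only [id, Fin.le_def, Fin.val_rev, Fin.rev_rev] at a1 a2
  omega
end HN

section Gram
variable {V : Type*} [NormedAddCommGroup V] [InnerProductSpace ℝ V]

lemma gram_comb {ι κ : Type*} [Fintype ι] (v : ι → V) (w : κ → V) (T : Matrix κ ι ℝ)
    (h : ∀ k, w k = ∑ i, T k i • v i) :
    Matrix.gram ℝ w = T * Matrix.gram ℝ v * T.transpose := by
  ext a b
  simp only [Matrix.gram_apply, Matrix.mul_apply, Matrix.transpose_apply, h, sum_inner, inner_sum,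
    real_inner_smul_left, real_inner_smul_right, Finset.sum_mul]
  refine Finset.sum_congr rfl fun i _ => Finset.sum_congr rfl fun j _ => ?_
  ring

lemma one_le_det_one_add {n : Type*} [Fintype n] [DecidableEq n] {P : Matrix n n ℝ}
    (hP : P.PosSemidef) : 1 ≤ (1 + P).det := by
  have hs := hP.isHermitian.spectral_theorem
  set U := hP.isHermitian.eigenvectorUnitary
  set D : Matrix n n ℝ := Matrix.diagonal (RCLike.ofReal ∘ hP.isHermitian.eigenvalues) with hD
  rw [Unitary.conjStarAlgAut_apply] at hs
  have hU : (U : Matrix n n ℝ) * star (U : Matrix n n ℝ) = 1 := Unitary.coe_mul_star_self U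
  have e : 1 + P = (U : Matrix n n ℝ) * (1 + D) * star (U : Matrix n n ℝ) := by
    rw [mul_add, add_mul, mul_one, hU, ← hs]
  have hdet : (U : Matrix n n ℝ).det * (star (U : Matrix n n ℝ)).det = 1 := by
    rw [← Matrix.det_mul, hU, Matrix.det_one]
  have : (1 + P).det = (1 + D).det := by
    rw [e, Matrix.det_mul, Matrix.det_mul]
    linear_combination (1 + D).det * hdet
  rw [this, hD, ← Matrix.diagonal_one, Matrix.diagonal_add, Matrix.det_diagonal]
  have := Finset.prod_le_prod (s := (Finset.univ : Finset n)) (f := fun _ => (1 : ℝ))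
    (g := fun i => 1 + hP.isHermitian.eigenvalues i) (fun i _ => zero_le_one)
    (fun i _ => by linarith [hP.eigenvalues_nonneg i])
  simpa using this

open scoped MatrixOrder in
open scoped Matrix.Norms.L2Operator in
lemma exists_conj {n : Type*} [Fintype n] [DecidableEq n] {B : Matrix n n ℝ}
    (hB : B.PosSemidef) : ∃ X : Matrix n n ℝ, B = X.conjTranspose * X :=
  CStarAlgebra.nonneg_iff_eq_star_mul_self.mp hB.nonneg

lemma det_le_det_add {n : Type*} [Fintype n] [DecidableEq n] {A B : Matrix n n ℝ}
    (hA : A.PosSemidef) (hB : B.PosSemidef) : A.det ≤ (A + B).det := by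
  by_cases h0 : A.det = 0
  · rw [h0]; exact (hA.add hB).det_nonneg
  have hAp : A.PosDef := hA.posDef_iff_det_ne_zero.2 h0
  obtain ⟨X, hX⟩ := exists_conj hB
  subst hX
  have hu : IsUnit A.det := isUnit_iff_ne_zero.2 h0
  have e : A + X.conjTranspose * X = A * (1 + A⁻¹ * X.conjTranspose * X) := by
    rw [mul_add, mul_one, ← mul_assoc, ← mul_assoc, Matrix.mul_nonsing_inv _ hu, one_mul]
  rw [e, Matrix.det_mul, Matrix.det_one_add_mul_comm]
  have hp : (X * (A⁻¹ * X.conjTranspose)).PosSemidef := by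
    rw [← mul_assoc]
    exact hAp.inv.posSemidef.mul_mul_conjTranspose_same X
  have := one_le_det_one_add hp
  nlinarith [hAp.det_pos]

lemma gram_proj_le {ι : Type*} [Fintype ι] [DecidableEq ι] (W : Submodule ℝ V)
    [W.HasOrthogonalProjection] (a : ι → V) :
    (Matrix.gram ℝ (fun i => W.starProjection (a i))).det ≤ (Matrix.gram ℝ a).det := by
  have : Matrix.gram ℝ a = Matrix.gram ℝ (fun i => W.starProjection (a i)) +
      Matrix.gram ℝ (fun i => Wᗮ.starProjection (a i)) := by
    ext i j
    simp only [Matrix.gram_apply, Matrix.add_apply]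
    have h1 : ∀ x, x = W.starProjection x + Wᗮ.starProjection x := fun x =>
      (W.starProjection_add_starProjection_orthogonal x).symm
    conv_lhs => rw [h1 (a i), h1 (a j)]
    rw [inner_add_left, inner_add_right, inner_add_right,
      Submodule.inner_right_of_mem_orthogonal (W.starProjection_apply_mem (a i))
        (Wᗮ.starProjection_apply_mem (a j)),
      Submodule.inner_left_of_mem_orthogonal (W.starProjection_apply_mem (a j))
        (Wᗮ.starProjection_apply_mem (a i))]
    ring
  rw [this]
  exact det_le_det_add (Matrix.posSemidef_gram _ _) (Matrix.posSemidef_gram _ _)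

lemma gram_sum {ι κ : Type*} [Fintype ι] [DecidableEq ι] [Fintype κ] [DecidableEq κ]
    (k : ι → V) (a : κ → V) (W : Submodule ℝ V) [W.HasOrthogonalProjection]
    (hW : Submodule.span ℝ (Set.range k) = W) :
    (Matrix.gram ℝ (Sum.elim k a)).det =
      (Matrix.gram ℝ k).det * (Matrix.gram ℝ (fun i => Wᗮ.starProjection (a i))).det := by
  have hc : ∀ j, ∃ c : ι → ℝ, ∑ i, c i • k i = W.starProjection (a j) := fun j => by
    rw [← Submodule.mem_span_range_iff_exists_fun, hW]
    exact W.starProjection_apply_mem (a j)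
  choose c hc using hc
  have h1 := gram_comb (Sum.elim k (fun i => Wᗮ.starProjection (a i))) (Sum.elim k a)
    (Matrix.fromBlocks 1 0 (Matrix.of c) 1) (by
      rintro (i | j)
      · simp [Fintype.sum_sum_type, Matrix.one_apply]
      · simp only [Fintype.sum_sum_type, Sum.elim_inl, Sum.elim_inr, Matrix.fromBlocks_apply₂₁,
          Matrix.fromBlocks_apply₂₂, Matrix.of_apply, hc]
        simp [Matrix.one_apply])
  have h2 : Matrix.gram ℝ (Sum.elim k (fun i => Wᗮ.starProjection (a i))) =
      Matrix.fromBlocks (Matrix.gram ℝ k) 0 0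
        (Matrix.gram ℝ (fun i => Wᗮ.starProjection (a i))) := by
    have hk : ∀ i, k i ∈ W := fun i => hW ▸ Submodule.subset_span ⟨i, rfl⟩
    ext (i | i) (j | j)
    · simp [Matrix.gram_apply]
    · simp only [Matrix.gram_apply, Sum.elim_inl, Sum.elim_inr, Matrix.fromBlocks_apply₁₂,
        Matrix.zero_apply]
      exact Submodule.inner_right_of_mem_orthogonal (hk i) (Wᗮ.starProjection_apply_mem (a j))
    · simp only [Matrix.gram_apply, Sum.elim_inl, Sum.elim_inr, Matrix.fromBlocks_apply₂₁,
        Matrix.zero_apply]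
      exact Submodule.inner_left_of_mem_orthogonal (hk j) (Wᗮ.starProjection_apply_mem (a i))
    · simp [Matrix.gram_apply]
  rw [h1, h2]
  simp [Matrix.det_mul, Matrix.det_transpose]

lemma gram_reindex {ι κ : Type*} [Fintype ι] [DecidableEq ι] [Fintype κ] [DecidableEq κ]
    (e : κ ≃ ι) (v : ι → V) : (Matrix.gram ℝ (v ∘ e)).det = (Matrix.gram ℝ v).det :=
  Matrix.det_submatrix_equiv_self e (Matrix.gram ℝ v)

/-- `v` is a `ℤ`-basis of `M` which is linearly independent over `ℝ`. -/
def IsB {ι : Type*} (v : ι → V) (M : Submodule ℤ V) : Prop :=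
  LinearIndependent ℝ v ∧ Submodule.span ℤ (Set.range v) = M

lemma gram_le {ι κ : Type*} [Fintype ι] [DecidableEq ι] [Fintype κ] [DecidableEq κ]
    (v : ι → V) (w : κ → V) (hcard : Fintype.card κ = Fintype.card ι)
    (hw : LinearIndependent ℝ w)
    (h : ∀ k, w k ∈ Submodule.span ℤ (Set.range v)) :
    (Matrix.gram ℝ v).det ≤ (Matrix.gram ℝ w).det := by
  have e := Fintype.equivOfCardEq hcard
  rw [← gram_reindex e v]
  have hc : ∀ j, ∃ c : κ → ℤ, ∑ i, c i • (v ∘ e) i = w j := fun j => by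
    rw [← Submodule.mem_span_range_iff_exists_fun, Set.range_comp, e.range_eq_univ, Set.image_univ]
    exact h j
  choose c hc using hc
  have h1 := gram_comb (v ∘ e) w ((Matrix.of c).map (Int.castRingHom ℝ)) (by
    intro k
    rw [← hc k]
    refine Finset.sum_congr rfl fun i _ => ?_
    simp [Int.cast_smul_eq_zsmul])
  have h2 : (Matrix.gram ℝ w).det = ((Matrix.of c).det : ℝ) ^ 2 * (Matrix.gram ℝ (v ∘ e)).det := by
    have := (Int.castRingHom ℝ).map_det (Matrix.of c)
    rw [h1, Matrix.det_mul, Matrix.det_mul, Matrix.det_transpose]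
    simp only [RingHom.mapMatrix_apply, eq_intCast] at this
    rw [this]
    ring
  have h3 : (Matrix.gram ℝ w).det ≠ 0 := Matrix.det_gram_ne_zero_iff_linearIndependent.2 hw
  have h4 : (Matrix.of c).det ≠ 0 := by
    intro h0
    apply h3
    rw [h2, h0]; simp
  have h5 : (1 : ℝ) ≤ ((Matrix.of c).det : ℝ) ^ 2 := by
    have : (1 : ℤ) ≤ (Matrix.of c).det ^ 2 := by
      have := sq_pos_of_ne_zero h4
      omega
    exact_mod_cast this
  have h6 := (Matrix.posSemidef_gram ℝ (v ∘ e)).det_nonneg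
  rw [h2]
  nlinarith

lemma covol_eq {ι : Type*} [Fintype ι] [DecidableEq ι] {v : ι → V} {M : Submodule ℤ V}
    (h : IsB v M) : covol M = Real.sqrt (Matrix.gram ℝ v).det := by
  obtain ⟨hv, rfl⟩ := h
  have hvz : LinearIndependent ℤ v := hv.restrict_scalars' ℤ
  let b := Basis.span hvz
  have hex : ∃ n : ℕ, Nonempty (Basis (Fin n) ℤ (Submodule.span ℤ (Set.range v))) :=
    ⟨_, ⟨b.reindex (Fintype.equivFin ι)⟩⟩
  unfold covol
  rw [dif_pos hex]
  set b' := hex.choose_spec.some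
  set w : Fin hex.choose → V := fun i => (b' i : V) with hw
  change Real.sqrt (Matrix.gram ℝ w).det = _
  have hcard : Fintype.card (Fin hex.choose) = Fintype.card ι :=
    Fintype.card_congr (b'.indexEquiv b)
  have hspan : Submodule.span ℤ (Set.range w) = Submodule.span ℤ (Set.range v) := by
    have := congrArg (Submodule.map (Submodule.span ℤ (Set.range v)).subtype) b'.span_eq
    rw [Submodule.map_span, Submodule.map_top, Submodule.range_subtype, ← Set.range_comp] at this
    exact this
  have hspanR : Submodule.span ℝ (Set.range w) = Submodule.span ℝ (Set.range v) := by
    rw [← Submodule.span_span_of_tower ℤ ℝ (Set.range w), hspan, Submodule.span_span_of_tower]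
  have hwR : LinearIndependent ℝ w := by
    rw [linearIndependent_iff_card_eq_finrank_span, Set.finrank, hspanR, hcard]
    exact linearIndependent_iff_card_eq_finrank_span.1 hv
  congr 1
  apply le_antisymm
  · apply gram_le _ _ hcard.symm hv
    rw [hspan]; exact fun i => Submodule.subset_span ⟨i, rfl⟩
  · apply gram_le _ _ hcard hwR
    exact fun i => (b' i).2

lemma IsB.covol_pos {ι : Type*} [Fintype ι] {v : ι → V} {M : Submodule ℤ V}
    (h : IsB v M) : 0 < covol M := by
  classical
  rw [covol_eq h, Real.sqrt_pos]
  exact lt_of_le_of_ne (Matrix.posSemidef_gram ℝ v).det_nonneg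
    (Matrix.det_gram_ne_zero_iff_linearIndependent.2 h.1).symm

lemma IsB.covol_sq {ι : Type*} [Fintype ι] [DecidableEq ι] {v : ι → V} {M : Submodule ℤ V}
    (h : IsB v M) : covol M ^ 2 = (Matrix.gram ℝ v).det := by
  rw [covol_eq h, Real.sq_sqrt (Matrix.posSemidef_gram ℝ v).det_nonneg]

lemma IsB.spanR {ι : Type*} {v : ι → V} {M : Submodule ℤ V} (h : IsB v M) :
    Submodule.span ℝ (Set.range v) = Submodule.span ℝ (M : Set V) := by
  rw [← h.2, Submodule.span_span_of_tower]

lemma IsB.finrank {ι : Type*} [Fintype ι] {v : ι → V} {M : Submodule ℤ V} (h : IsB v M) :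
    finrank ℝ (Submodule.span ℝ (M : Set V)) = Fintype.card ι := by
  rw [← h.spanR, finrank_span_eq_card h.1]

lemma IsB.map {U : Type*} [NormedAddCommGroup U] [InnerProductSpace ℝ U]
    {ι : Type*} {v : ι → V} {M : Submodule ℤ V} (h : IsB v M)
    (φ : V →ₗ[ℝ] U) (hφ : LinearIndependent ℝ (φ ∘ v)) :
    IsB (φ ∘ v) (M.map (φ.restrictScalars ℤ)) := by
  refine ⟨hφ, ?_⟩
  rw [← h.2, Submodule.map_span, ← Set.range_comp]
  rfl

/-- similarities scale the covolume -/
lemma IsB.covol_map {U : Type*} [NormedAddCommGroup U] [InnerProductSpace ℝ U]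
    {ι : Type*} [Fintype ι] {v : ι → V} {M : Submodule ℤ V} (h : IsB v M)
    (φ : V →ₗ[ℝ] U) (α : ℝ) (hα : 0 < α) (hφ : ∀ x y, inner ℝ (φ x) (φ y) = α * inner ℝ x y) :
    IsB (φ ∘ v) (M.map (φ.restrictScalars ℤ)) ∧
    covol (M.map (φ.restrictScalars ℤ)) ^ 2 = α ^ Fintype.card ι * covol M ^ 2 := by
  classical
  have hinj : Function.Injective φ := by
    rw [injective_iff_map_eq_zero]
    intro x hx
    have := hφ x x
    rw [hx, inner_zero_left] at this
    have := (mul_eq_zero.1 this.symm).resolve_left hα.ne'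
    exact inner_self_eq_zero.1 this
  have hb := h.map φ (h.1.map' φ (LinearMap.ker_eq_bot.2 hinj))
  refine ⟨hb, ?_⟩
  rw [hb.covol_sq, h.covol_sq, ← Matrix.det_smul]
  congr 1
  ext i j
  simp [Matrix.gram_apply, hφ]

end Gram

section Lat
variable {V : Type*} [NormedAddCommGroup V] [InnerProductSpace ℝ V] [FiniteDimensional ℝ V]

/-- `L ∩ F` as a subgroup of the ambient space. -/
def cap (L : Submodule ℤ V) (F : Submodule ℝ V) : Submodule ℤ V := L ⊓ F.restrictScalars ℤ

lemma mem_cap {L : Submodule ℤ V} {F : Submodule ℝ V} {x : V} :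
    x ∈ cap L F ↔ x ∈ L ∧ x ∈ F := Iff.rfl

lemma rat_iff {L : Submodule ℤ V} {F : Submodule ℝ V} :
    IsRational L F ↔ Submodule.span ℝ (cap L F : Set V) = F := Iff.rfl

/-- projection along `F` as a `ℤ`-linear map -/
def pr (F : Submodule ℝ V) : V →ₗ[ℤ] V := (Fᗮ.starProjection : V →ₗ[ℝ] V).restrictScalars ℤ

lemma pr_apply (F : Submodule ℝ V) (x : V) : pr F x = Fᗮ.starProjection x := rfl

lemma pr_eq_zero {F : Submodule ℝ V} {x : V} : pr F x = 0 ↔ x ∈ F := by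
  rw [pr_apply, Submodule.starProjection_apply_eq_zero_iff, Submodule.orthogonal_orthogonal]

lemma sub_pr_mem (F : Submodule ℝ V) (x : V) : x - pr F x ∈ F := by
  rw [pr_apply, sub_eq_iff_eq_add.2 (F.starProjection_add_starProjection_orthogonal x).symm]
  exact F.starProjection_apply_mem x

lemma li_of_int {L : Submodule ℤ V} (hL : DiscreteTopology L) {ι : Type*} [Fintype ι] {v : ι → V}
    (hv : LinearIndependent ℤ v) (h : ∀ i, v i ∈ L) : LinearIndependent ℝ v := by
  have hle : Submodule.span ℤ (Set.range v) ≤ L := Submodule.span_le.2 (by rintro _ ⟨i, rfl⟩; exact h i)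
  have hd : DiscreteTopology (Submodule.span ℤ (Set.range v)) :=
    DiscreteTopology.of_subset hL hle
  rw [linearIndependent_iff_card_eq_finrank_span, Real.finrank_eq_int_finrank_of_discrete hd]
  exact linearIndependent_iff_card_eq_finrank_span.1 hv

lemma exists_isB {L : Submodule ℤ V} (hL : DiscreteTopology L) {M : Submodule ℤ V} (hM : M ≤ L) :
    ∃ (n : ℕ) (v : Fin n → V), IsB v M := by
  have hd : DiscreteTopology M := DiscreteTopology.of_subset hL hM
  let b := finBasis ℤ M
  refine ⟨_, fun i => (b i : V), li_of_int hL ?_ (fun i => hM (b i).2), ?_⟩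
  · exact b.linearIndependent.map' M.subtype (Submodule.ker_subtype M)
  · have := congrArg (Submodule.map M.subtype) b.span_eq
    rw [Submodule.map_span, Submodule.map_top, Submodule.range_subtype, ← Set.range_comp] at this
    exact this

lemma exists_ext {L : Submodule ℤ V} (hL : DiscreteTopology L) {M : Submodule ℤ V} (hM : M ≤ L)
    (F : Submodule ℝ V) {ι : Type*} [Fintype ι] {k : ι → V} (hk : IsB k (cap M F)) :
    ∃ (n : ℕ) (a : Fin n → V), IsB (Sum.elim k a) M := by
  have hd : DiscreteTopology M := DiscreteTopology.of_subset hL hM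
  have hfin : Module.Finite ℤ M := inferInstance
  have : Module.Finite ℤ (M.map (pr F)) := Module.Finite.map _ _
  have : Module.IsTorsionFree ℤ V := .trans_faithfulSMul ℤ ℝ V
  let b := finBasis ℤ (M.map (pr F))
  have hb : ∀ i, ∃ a ∈ M, pr F a = b i := fun i => (b i).2
  choose a ha hab using hb
  have hkM : ∀ i, k i ∈ cap M F := fun i => hk.2 ▸ Submodule.subset_span ⟨i, rfl⟩
  have hbi : LinearIndependent ℤ (fun i => (b i : V)) :=
    b.linearIndependent.map' (M.map (pr F)).subtype (Submodule.ker_subtype _)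
  have hai : LinearIndependent ℤ a := by
    apply LinearIndependent.of_comp (pr F)
    convert hbi using 1
    funext i; exact hab i
  refine ⟨_, a, li_of_int hL ?_ ?_, ?_⟩
  · refine LinearIndependent.sum_type (hk.1.restrict_scalars' ℤ) hai ?_
    rw [Submodule.disjoint_def]
    intro x hx hx'
    rw [hk.2] at hx
    obtain ⟨c, rfl⟩ := (Submodule.mem_span_range_iff_exists_fun ℤ).1 hx'
    have h0 := pr_eq_zero.2 hx.2
    simp only [map_sum, map_zsmul, hab] at h0
    have := Fintype.linearIndependent_iff.1 hbi c h0
    simp [this]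
  · rintro (i | i)
    · exact hM (hkM i).1
    · exact hM (ha i)
  · rw [Set.Sum.elim_range, Submodule.span_union, hk.2]
    apply le_antisymm
    · refine sup_le (fun x hx => hx.1) (Submodule.span_le.2 ?_)
      rintro _ ⟨i, rfl⟩; exact ha i
    · intro x hx
      have h1 : (⟨pr F x, ⟨x, hx, rfl⟩⟩ : M.map (pr F)) ∈ Submodule.span ℤ (Set.range b) := by
        rw [b.span_eq]; trivial
      obtain ⟨c, hc⟩ := (Submodule.mem_span_range_iff_exists_fun ℤ).1 h1
      have hc' := congrArg Subtype.val hc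
      simp only [Submodule.coe_sum, Submodule.coe_smul] at hc'
      have h2 : ∑ i, c i • a i ∈ Submodule.span ℤ (Set.range a) :=
        (Submodule.mem_span_range_iff_exists_fun ℤ).2 ⟨c, rfl⟩
      have h3 : x - ∑ i, c i • a i ∈ cap M F := by
        refine ⟨M.sub_mem hx (M.sum_mem fun i _ => M.smul_mem _ (ha i)), ?_⟩
        apply pr_eq_zero.1
        simp only [map_sub, map_sum, map_zsmul, hab]
        rw [hc', sub_self]
      have := Submodule.add_mem_sup h3 h2
      simpa using this

/-- the projected part of an extended basis -/
lemma isB_pr {M : Submodule ℤ V} {F : Submodule ℝ V} {ι κ : Type*} [Fintype ι] [Fintype κ]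
    [DecidableEq ι] [DecidableEq κ]
    {k : ι → V} (hk : IsB k (cap M F)) (hF : IsRational M F) {a : κ → V}
    (h : IsB (Sum.elim k a) M) :
    IsB (fun i => pr F (a i)) (M.map (pr F)) ∧
      covol M ^ 2 = covol (cap M F) ^ 2 * covol (M.map (pr F)) ^ 2 := by
  have hg := gram_sum k a F (hk.spanR.trans hF)
  have hne := Matrix.det_gram_ne_zero_iff_linearIndependent.2 h.1
  rw [hg] at hne
  have hB : IsB (fun i => pr F (a i)) (M.map (pr F)) := by
    refine ⟨Matrix.det_gram_ne_zero_iff_linearIndependent.1 (right_ne_zero_of_mul hne), ?_⟩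
    conv_rhs => rw [← h.2]
    rw [Set.Sum.elim_range, Submodule.span_union, Submodule.map_sup, hk.2, Submodule.map_span,
      ← Set.range_comp]
    have : (cap M F).map (pr F) = ⊥ := by
      rw [eq_bot_iff]
      rintro _ ⟨x, hx, rfl⟩
      exact pr_eq_zero.2 hx.2
    rw [this, bot_sup_eq]
    rfl
  refine ⟨hB, ?_⟩
  rw [h.covol_sq, hg, hk.covol_sq, hB.covol_sq]
  rfl

lemma cap_cap {L : Submodule ℤ V} {F G : Submodule ℝ V} (h : F ≤ G) :
    cap (cap L G) F = cap L F := by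
  ext x
  simp only [mem_cap]
  exact ⟨fun ⟨⟨a, _⟩, c⟩ => ⟨a, c⟩, fun ⟨a, c⟩ => ⟨⟨a, h c⟩, c⟩⟩

/-- multiplicativity of covolumes -/
lemma covol_quot {L : Submodule ℤ V} (hL : DiscreteTopology L) {F G : Submodule ℝ V} (h : F ≤ G)
    (hF : IsRational L F) :
    (∃ (n : ℕ) (v : Fin n → V), IsB v ((cap L G).map (pr F))) ∧
    Real.log (covol ((cap L G).map (pr F))) =
      Real.log (covol (cap L G)) - Real.log (covol (cap L F)) := by
  have hle : cap L G ≤ L := inf_le_left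
  obtain ⟨m, k, hk⟩ := exists_isB hL (M := cap (cap L G) F) (inf_le_left.trans hle)
  obtain ⟨n, a, ha⟩ := exists_ext hL hle F hk
  have hF' : IsRational (cap L G) F := by
    rw [rat_iff, cap_cap h]; exact hF
  obtain ⟨h1, h2⟩ := isB_pr hk hF' ha
  refine ⟨⟨n, _, h1⟩, ?_⟩
  have p1 := h1.covol_pos
  have p2 := hk.covol_pos
  rw [cap_cap h] at h2 p2
  have := congrArg Real.log h2
  rw [Real.log_mul (by positivity) (by positivity), Real.log_pow, Real.log_pow, Real.log_pow] at this
  push_cast at this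
  linarith

lemma rat_sup {L : Submodule ℤ V} {F G : Submodule ℝ V} (hF : IsRational L F)
    (hG : IsRational L G) : IsRational L (F ⊔ G) := by
  rw [rat_iff] at *
  apply le_antisymm
  · exact Submodule.span_le.2 fun x hx => hx.2
  · refine sup_le ?_ ?_
    · conv_lhs => rw [← hF]
      exact Submodule.span_mono fun x hx => ⟨hx.1, (le_sup_left : F ≤ F ⊔ G) hx.2⟩
    · conv_lhs => rw [← hG]
      exact Submodule.span_mono fun x hx => ⟨hx.1, (le_sup_right : G ≤ F ⊔ G) hx.2⟩

lemma finrank_int {L : Submodule ℤ V} (hL : DiscreteTopology L) {M : Submodule ℤ V} (hM : M ≤ L) :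
    finrank ℝ (Submodule.span ℝ (M : Set V)) = finrank ℤ M := by
  have := Real.finrank_eq_int_finrank_of_discrete (s := (M : Set V))
    (by rw [Submodule.span_eq]; exact DiscreteTopology.of_subset hL hM)
  rw [Set.finrank, Set.finrank, Submodule.span_eq] at this
  exact this

lemma rat_inf {L : Submodule ℤ V} (hL : DiscreteTopology L) {F G : Submodule ℝ V}
    (hF : IsRational L F) (hG : IsRational L G) : IsRational L (F ⊓ G) := by
  rw [rat_iff] at *
  have hle : Submodule.span ℝ (cap L (F ⊓ G) : Set V) ≤ F ⊓ G :=
    Submodule.span_le.2 fun x hx => hx.2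
  apply Submodule.eq_of_le_of_finrank_eq hle
  have e1 : cap L F ⊓ cap L G = cap L (F ⊓ G) := by
    ext x; simp only [Submodule.mem_inf, mem_cap]; tauto
  have l1 : cap L F ≤ L := inf_le_left
  have l2 : cap L G ≤ L := inf_le_left
  have l3 : cap L (F ⊓ G) ≤ L := inf_le_left
  have f1 := finrank_int hL l1
  have f2 := finrank_int hL l2
  have f3 := finrank_int hL l3
  have f4 := finrank_int hL (sup_le l1 l2)
  have e2 : Submodule.span ℝ ((cap L F ⊔ cap L G : Submodule ℤ V) : Set V) = F ⊔ G := by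
    apply le_antisymm
    · refine Submodule.span_le.2 fun x hx => ?_
      obtain ⟨y, hy, z, hz, rfl⟩ := Submodule.mem_sup.1 hx
      exact Submodule.add_mem_sup hy.2 hz.2
    · refine sup_le ?_ ?_
      · conv_lhs => rw [← hF]
        exact Submodule.span_mono (le_sup_left : cap L F ≤ _)
      · conv_lhs => rw [← hG]
        exact Submodule.span_mono (le_sup_right : cap L G ≤ _)
  have d1 : DiscreteTopology (cap L F) := DiscreteTopology.of_subset hL l1
  have d2 : DiscreteTopology (cap L G) := DiscreteTopology.of_subset hL l2
  have d3 : DiscreteTopology (cap L (F ⊓ G)) := DiscreteTopology.of_subset hL l3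
  have d4 : DiscreteTopology ↥(cap L F ⊔ cap L G) := DiscreteTopology.of_subset hL (sup_le l1 l2)
  have hr := Submodule.rank_sup_add_rank_inf_eq (cap L F) (cap L G)
  rw [e1] at hr
  simp only [← finrank_eq_rank] at hr
  have hr' : finrank ℤ ↥(cap L F ⊔ cap L G) + finrank ℤ (cap L (F ⊓ G)) =
    finrank ℤ (cap L F) + finrank ℤ (cap L G) := by exact_mod_cast hr
  have hd := Submodule.finrank_sup_add_finrank_inf_eq F G
  rw [hF] at f1
  rw [hG] at f2
  rw [e2] at f4
  omega

/-- The log-covolume function. -/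
def lc (L : Submodule ℤ V) (F : Submodule ℝ V) : ℝ := Real.log (covol (cap L F))

lemma lc_sub {L : Submodule ℤ V} (hL : DiscreteTopology L) {F G : Submodule ℝ V}
    (hF : IsRational L F) (hG : IsRational L G) :
    lc L (F ⊔ G) + lc L (F ⊓ G) ≤ lc L F + lc L G := by
  have hI := rat_inf hL hF hG
  have hS := rat_sup hF hG
  have eK : cap (cap L F) (F ⊓ G) = cap L (F ⊓ G) := cap_cap inf_le_left
  obtain ⟨nk, k, hk⟩ := exists_isB hL (M := cap L (F ⊓ G)) inf_le_left
  obtain ⟨na, a, ha⟩ := exists_ext hL (M := cap L F) inf_le_left (F ⊓ G) (eK.symm ▸ hk)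
  obtain ⟨nb, b, hb⟩ := exists_isB hL (M := cap L G) inf_le_left
  obtain ⟨nu, u, hu⟩ := exists_isB hL (M := cap L (F ⊔ G)) inf_le_left
  have ck := hk.finrank
  have ca := ha.finrank
  have cb := hb.finrank
  have cu := hu.finrank
  rw [rat_iff.1 hI] at ck
  rw [rat_iff.1 hF] at ca
  rw [rat_iff.1 hG] at cb
  rw [rat_iff.1 hS] at cu
  simp only [Fintype.card_fin, Fintype.card_sum] at ck ca cb cu
  have hd := Submodule.finrank_sup_add_finrank_inf_eq F G
  have haF : ∀ i, a i ∈ cap L F := fun i => ha.2 ▸ Submodule.subset_span ⟨Sum.inr i, rfl⟩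
  have hbG : ∀ i, b i ∈ cap L G := fun i => hb.2 ▸ Submodule.subset_span ⟨i, rfl⟩
  have hkG : ∀ i, k i ∈ cap L (F ⊓ G) := fun i => hk.2 ▸ Submodule.subset_span ⟨i, rfl⟩
  have hspan : Submodule.span ℝ (Set.range (Sum.elim b a)) = F ⊔ G := by
    rw [Set.Sum.elim_range, Submodule.span_union, hb.spanR, rat_iff.1 hG]
    have h1 := ha.spanR
    rw [Set.Sum.elim_range, Submodule.span_union, hk.spanR, rat_iff.1 hI, rat_iff.1 hF] at h1
    conv_rhs => rw [← h1, sup_right_comm, sup_eq_right.2 (inf_le_right : F ⊓ G ≤ G)]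
  have hli : LinearIndependent ℝ (Sum.elim b a) := by
    rw [linearIndependent_iff_card_eq_finrank_span, Set.finrank, hspan]
    simp only [Fintype.card_fin, Fintype.card_sum]
    omega
  have i1 : (Matrix.gram ℝ u).det ≤ (Matrix.gram ℝ (Sum.elim b a)).det := by
    apply gram_le _ _ _ hli
    · rw [hu.2]
      rintro (i | i)
      · exact ⟨(hbG i).1, (le_sup_right : G ≤ F ⊔ G) (hbG i).2⟩
      · exact ⟨(haF i).1, (le_sup_left : F ≤ F ⊔ G) (haF i).2⟩
    · simp only [Fintype.card_fin, Fintype.card_sum]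
      omega
  rw [gram_sum b a G (hb.spanR.trans hG)] at i1
  have i2 := gram_sum k a (F ⊓ G) (hk.spanR.trans hI)
  have i3 := gram_proj_le Gᗮ (fun i => (F ⊓ G)ᗮ.starProjection (a i))
  have i4 : ∀ x, Gᗮ.starProjection ((F ⊓ G)ᗮ.starProjection x) = Gᗮ.starProjection x := by
    intro x
    have := Submodule.starProjection_comp_starProjection_of_le
      (Submodule.orthogonal_le (inf_le_right : F ⊓ G ≤ G))
    exact congrArg (fun φ : V →L[ℝ] V => φ x) this
  simp only [i4] at i3
  rw [← hu.covol_sq, ← hb.covol_sq] at i1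
  rw [← ha.covol_sq, ← hk.covol_sq] at i2
  have pu := hu.covol_pos
  have pk := hk.covol_pos
  have pb := hb.covol_pos
  have pa := ha.covol_pos
  have key : covol (cap L (F ⊔ G)) ^ 2 * covol (cap L (F ⊓ G)) ^ 2 ≤
      covol (cap L F) ^ 2 * covol (cap L G) ^ 2 := by
    rw [i2]
    have q := mul_le_mul_of_nonneg_left i3 (by positivity : 0 ≤ covol (cap L G) ^ 2)
    have := mul_le_mul_of_nonneg_right (i1.trans q)
      (by positivity : 0 ≤ covol (cap L (F ⊓ G)) ^ 2)
    linarith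
  have := Real.log_le_log (by positivity) key
  rw [Real.log_mul (by positivity) (by positivity), Real.log_mul (by positivity) (by positivity),
    Real.log_pow, Real.log_pow, Real.log_pow, Real.log_pow] at this
  unfold lc
  push_cast at this
  linarith

lemma covol_isom {U : Type*} [NormedAddCommGroup U] [InnerProductSpace ℝ U] (M : Submodule ℤ U)
    (φ : U →ₗ[ℝ] V) (hφ : ∀ x y, inner ℝ (φ x) (φ y) = inner ℝ x y) {N : Submodule ℤ V}
    (hN : M.map (φ.restrictScalars ℤ) = N) {ι : Type*} [Fintype ι] {w : ι → V} (hw : IsB w N) :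
    covol M = covol N ∧ 0 < covol M := by
  have hinj : Function.Injective φ := by
    rw [injective_iff_map_eq_zero]
    intro x hx
    have := hφ x x
    rw [hx, inner_zero_left] at this
    exact inner_self_eq_zero.1 this.symm
  have h1 : ∀ i, ∃ v ∈ M, φ v = w i := fun i => by
    have : w i ∈ N := hw.2 ▸ Submodule.subset_span ⟨i, rfl⟩
    rw [← hN] at this
    exact this
  choose v hvM hv using h1
  have hv' : φ ∘ v = w := funext hv
  have hB : IsB v M := by
    refine ⟨LinearIndependent.of_comp φ (hv' ▸ hw.1), ?_⟩
    apply Submodule.map_injective_of_injective (f := φ.restrictScalars ℤ) hinj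
    rw [hN, Submodule.map_span, ← Set.range_comp, ← hw.2, ← hv']
    rfl
  have := (hB.covol_map φ 1 one_pos (by simpa using hφ)).2
  rw [one_pow, one_mul, hN] at this
  exact ⟨((sq_eq_sq₀ hw.covol_pos.le hB.covol_pos.le).1 this).symm, hB.covol_pos⟩

end Lat

section SS
variable {V : Type*} [NormedAddCommGroup V] [InnerProductSpace ℝ V] [FiniteDimensional ℝ V]

/-- inclusion of the ambient space of `succQuot` -/
def inc (F F' : Submodule ℝ V) : ↥((F.comap F'.subtype)ᗮ) →ₗ[ℝ] V :=
  F'.subtype ∘ₗ ((F.comap F'.subtype)ᗮ).subtype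

lemma inc_inj (F F' : Submodule ℝ V) : Function.Injective (inc F F') :=
  F'.injective_subtype.comp ((F.comap F'.subtype)ᗮ).injective_subtype

lemma inc_inner (F F' : Submodule ℝ V) (x y) :
    inner ℝ (inc F F' x) (inc F F' y) = inner ℝ x y := rfl

lemma inc_range {F F' : Submodule ℝ V} (h : F ≤ F') : LinearMap.range (inc F F') = Fᗮ ⊓ F' := by
  ext x
  constructor
  · rintro ⟨y, rfl⟩
    refine ⟨?_, y.1.2⟩
    change _ ∈ Fᗮ
    rw [Submodule.mem_orthogonal]
    intro u hu
    exact (Submodule.mem_orthogonal _ _).1 y.2 ⟨u, h hu⟩ hu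
  · rintro ⟨h1, h2⟩
    refine ⟨⟨⟨x, h2⟩, ?_⟩, rfl⟩
    rw [Submodule.mem_orthogonal]
    intro u hu
    exact (Submodule.mem_orthogonal _ _).1 h1 u.1 hu

lemma inc_proj {F F' : Submodule ℝ V} (h : F ≤ F') (x : F') :
    inc F F' (Submodule.orthogonalProjectionOnto ((F.comap F'.subtype)ᗮ) x) = pr F x := by
  set S := (F.comap F'.subtype)ᗮ with hS
  rw [pr_apply]
  symm
  apply Submodule.eq_starProjection_of_mem_orthogonal
  · have : inc F F' (S.orthogonalProjectionOnto x) ∈ LinearMap.range (inc F F') := ⟨_, rfl⟩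
    rw [inc_range h] at this
    exact this.1
  · rw [Submodule.orthogonal_orthogonal]
    have h1 : x - S.starProjection x ∈ Sᗮ := Submodule.sub_starProjection_mem_orthogonal x
    have hSS : Sᗮ = F.comap F'.subtype := by rw [hS, Submodule.orthogonal_orthogonal]
    rw [hSS] at h1
    exact h1

lemma succQuot_mem {L : Submodule ℤ V} {F F' : Submodule ℝ V} (h : F ≤ F')
    (y : ↥((F.comap F'.subtype)ᗮ)) :
    y ∈ succQuot L F F' ↔ ∃ x ∈ cap L F', pr F x = inc F F' y := by
  unfold succQuot quotLat
  rw [Submodule.mem_map]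
  constructor
  · rintro ⟨x, hx, rfl⟩
    exact ⟨x, ⟨hx, x.2⟩, (inc_proj h x).symm⟩
  · rintro ⟨x, hx, e⟩
    refine ⟨⟨x, hx.2⟩, hx.1, ?_⟩
    apply inc_inj
    rw [← e]
    exact inc_proj h ⟨x, hx.2⟩

lemma pr_mem_iff {F G : Submodule ℝ V} (h : F ≤ G) (x : V) : pr F x ∈ G ↔ x ∈ G := by
  have h1 := h (sub_pr_mem F x)
  constructor
  · intro h2
    simpa using G.add_mem h1 h2
  · intro h2
    simpa using G.sub_mem h2 h1

lemma succQuot_map {L : Submodule ℤ V} {F F' : Submodule ℝ V} (h : F ≤ F') :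
    (succQuot L F F').map ((inc F F').restrictScalars ℤ) = (cap L F').map (pr F) := by
  ext z
  simp only [Submodule.mem_map]
  constructor
  · rintro ⟨y, hy, rfl⟩
    exact (succQuot_mem h y).1 hy
  · rintro ⟨x, hx, rfl⟩
    refine ⟨_, (succQuot_mem h _).2 ⟨x, hx, ?_⟩, inc_proj h ⟨x, hx.2⟩⟩
    exact (inc_proj h ⟨x, hx.2⟩).symm

lemma latIn_map {L : Submodule ℤ V} {F G F' : Submodule ℝ V} (h : F ≤ G) (h' : G ≤ F') :
    (latIn (succQuot L F F') (G.comap (inc F F'))).map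
      (((inc F F') ∘ₗ (G.comap (inc F F')).subtype).restrictScalars ℤ) = (cap L G).map (pr F) := by
  ext z
  simp only [Submodule.mem_map]
  constructor
  · rintro ⟨y, hy, rfl⟩
    obtain ⟨x, hx, e⟩ := (succQuot_mem (h.trans h') _).1 hy
    refine ⟨x, ⟨hx.1, ?_⟩, e⟩
    have : inc F F' y.1 ∈ G := y.2
    change x ∈ G
    refine (pr_mem_iff h x).1 ?_
    rw [e]
    exact this
  · rintro ⟨x, hx, rfl⟩
    have e := inc_proj (h.trans h') ⟨x, h' hx.2⟩
    refine ⟨⟨Submodule.orthogonalProjectionOnto ((F.comap F'.subtype)ᗮ) ⟨x, h' hx.2⟩, ?_⟩, ?_, e⟩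
    · rw [Submodule.mem_comap, e]
      exact (pr_mem_iff h x).2 hx.2
    · exact (succQuot_mem (h.trans h') _).2 ⟨x, ⟨hx.1, h' hx.2⟩, e.symm⟩

lemma comap_map_inc {F G F' : Submodule ℝ V} (h : F ≤ G) (h' : G ≤ F') :
    (G.comap (inc F F')).map (inc F F') = Fᗮ ⊓ G := by
  rw [Submodule.map_comap_eq, inc_range (h.trans h'), inf_assoc, inf_eq_right.2 h']

lemma rat_comap {L : Submodule ℤ V} {F G F' : Submodule ℝ V} (h : F ≤ G) (h' : G ≤ F')
    (hG : IsRational L G) : IsRational (succQuot L F F') (G.comap (inc F F')) := by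
  unfold IsRational
  apply Submodule.map_injective_of_injective (inc_inj F F')
  rw [comap_map_inc h h', Submodule.map_span]
  have e1 : (inc F F') '' ((succQuot L F F' : Set _) ∩ (G.comap (inc F F') : Set _)) =
      (((Fᗮ.starProjection : V →L[ℝ] V) : V →ₗ[ℝ] V)) '' (cap L G : Set V) := by
    have := congrArg (fun M : Submodule ℤ V => (M : Set V)) (latIn_map (L := L) h h')
    simp only [Submodule.map_coe] at this
    refine Eq.trans ?_ this
    ext z
    constructor
    · rintro ⟨y, ⟨hy, hy'⟩, rfl⟩
      exact ⟨⟨y, hy'⟩, hy, rfl⟩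
    · rintro ⟨y, hy, rfl⟩
      exact ⟨y.1, ⟨hy, y.2⟩, rfl⟩
  rw [e1, ← Submodule.map_span, rat_iff.1 hG]
  ext z
  constructor
  · rintro ⟨x, hx, rfl⟩
    exact ⟨Fᗮ.starProjection_apply_mem x, (pr_mem_iff h x).2 hx⟩
  · rintro ⟨h1, h2⟩
    exact ⟨z, h2, Submodule.starProjection_eq_self_iff.2 h1⟩

lemma finrank_comap {F G F' : Submodule ℝ V} (h : F ≤ G) (h' : G ≤ F') :
    (finrank ℝ (G.comap (inc F F')) : ℝ) = finrank ℝ G - finrank ℝ F := by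
  have h1 := Submodule.finrank_add_inf_finrank_orthogonal h
  rw [← comap_map_inc h h',
    ← (Submodule.equivMapOfInjective (inc F F') (inc_inj F F') _).finrank_eq] at h1
  rw [← h1]; push_cast; ring

lemma log_redH {L : Submodule ℤ V} (hL : DiscreteTopology L) {F F' : Submodule ℝ V} (h : F ≤ F')
    (hF : IsRational L F) :
    0 < redH (succQuot L F F') ∧ Real.log (redH (succQuot L F F')) =
      ((finrank ℝ F' : ℝ) - finrank ℝ F)⁻¹ * (lc L F' - lc L F) := by
  obtain ⟨⟨n, v, hv⟩, h2⟩ := covol_quot hL h hF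
  obtain ⟨e, p⟩ := covol_isom _ (inc F F') (inc_inner F F') (succQuot_map (L := L) h) hv
  unfold redH
  refine ⟨Real.rpow_pos_of_pos p _, ?_⟩
  rw [Real.log_rpow p, e, h2]
  have h3 : (finrank ℝ ↥((F.comap F'.subtype)ᗮ) : ℝ) = finrank ℝ F' - finrank ℝ F := by
    rw [← finrank_comap h le_rfl]
    have : F'.comap (inc F F') = ⊤ := by
      rw [eq_top_iff]; intro y _; exact y.1.2
    rw [this, finrank_top]
  rw [h3]; rfl

lemma log_Hr {L : Submodule ℤ V} (hL : DiscreteTopology L) {F G F' : Submodule ℝ V} (h : F ≤ G)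
    (h' : G ≤ F') (hF : IsRational L F) :
    0 < Hr (succQuot L F F') (G.comap (inc F F')) ∧
    Real.log (Hr (succQuot L F F') (G.comap (inc F F'))) =
      ((finrank ℝ G : ℝ) - finrank ℝ F)⁻¹ * (lc L G - lc L F) := by
  obtain ⟨⟨n, v, hv⟩, h2⟩ := covol_quot hL h hF
  obtain ⟨e, p⟩ := covol_isom _ ((inc F F') ∘ₗ (G.comap (inc F F')).subtype)
    (fun x y => inc_inner F F' x y) (latIn_map (L := L) h h') hv
  unfold Hr redH
  refine ⟨Real.rpow_pos_of_pos p _, ?_⟩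
  rw [Real.log_rpow p, e, h2, finrank_comap h h']
  rfl

lemma ss_ge {L : Submodule ℤ V} (hL : DiscreteTopology L) {F G F' : Submodule ℝ V} (h : F ≤ G)
    (h' : G ≤ F') (hF : IsRational L F) (hG : IsRational L G)
    (hs : Semistable (succQuot L F F')) :
    Real.log (redH (succQuot L F F')) * ((finrank ℝ G : ℝ) - finrank ℝ F) ≤ lc L G - lc L F := by
  rcases h.eq_or_lt with rfl | hlt
  · simp
  have hd : (0 : ℝ) < (finrank ℝ G : ℝ) - finrank ℝ F := by
    rw [sub_pos]; exact_mod_cast Submodule.finrank_lt_finrank_of_lt hlt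
  have hne : G.comap (inc F F') ≠ ⊥ := by
    intro h0
    have := finrank_comap h h'
    rw [h0, finrank_bot] at this
    simp at this
    linarith
  have h1 := hs _ hne (rat_comap h h' hG)
  obtain ⟨p, -⟩ := log_redH hL (h.trans h') hF
  have h2 := Real.log_le_log p h1
  rw [(log_Hr hL h h' hF).2] at h2
  have := mul_le_mul_of_nonneg_right h2 hd.le
  rwa [mul_comm _ (lc L G - lc L F), mul_assoc, inv_mul_cancel₀ hd.ne', mul_one] at this

end SS

section Dual
variable {V : Type*} [NormedAddCommGroup V] [InnerProductSpace ℝ V] [FiniteDimensional ℝ V]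

lemma gram_dual {ι : Type*} [Fintype ι] [DecidableEq ι] (W : Submodule ℝ V) (p q : ι → V)
    (hp : Submodule.span ℝ (Set.range p) = W) (hq : ∀ i, q i ∈ W)
    (hpq : ∀ i j, inner ℝ (q i) (p j) = if i = j then (1 : ℝ) else 0) :
    (Matrix.gram ℝ q).det * (Matrix.gram ℝ p).det = 1 := by
  rw [← Matrix.det_mul]
  have : Matrix.gram ℝ q * Matrix.gram ℝ p = 1 := by
    ext i k
    have h1 : q i ∈ Submodule.span ℝ (Set.range p) := hp ▸ hq i
    obtain ⟨c, hc⟩ := (Submodule.mem_span_range_iff_exists_fun ℝ).1 h1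
    have h2 : ∀ j, inner ℝ (q i) (q j) = c j := by
      intro j
      have h3 : inner ℝ (∑ x, c x • p x) (q j) = c j := by
        rw [sum_inner]
        simp only [real_inner_smul_left, fun x => real_inner_comm (q j) (p x), hpq]
        simp
      rwa [hc] at h3
    rw [Matrix.mul_apply, Matrix.one_apply, ← hpq i k]
    conv_rhs => rw [← hc, sum_inner]
    refine Finset.sum_congr rfl fun j _ => ?_
    rw [Matrix.gram_apply, Matrix.gram_apply, h2, real_inner_smul_left]
  rw [this, Matrix.det_one]

/-- covolume of the annihilator of `G` in the dual lattice -/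
lemma dual_covol {L : Submodule ℤ V} (hL : IsLat L) {G : Submodule ℝ V} (hG : IsRational L G) :
    ∃ (m : ℕ) (v : Fin m → V), IsB v (cap (dualLat L) Gᗮ) ∧ m + finrank ℝ G = finrank ℝ V ∧
      covol L ^ 2 * covol (cap (dualLat L) Gᗮ) ^ 2 = covol (cap L G) ^ 2 := by
  obtain ⟨nk, k, hk⟩ := exists_isB hL.1 (M := cap L G) inf_le_left
  obtain ⟨m, a, ha⟩ := exists_ext hL.1 le_rfl G hk
  obtain ⟨hp, hcov⟩ := isB_pr hk hG ha
  have hsp : Submodule.span ℝ (Set.range (Sum.elim k a)) = ⊤ := ha.spanR.trans hL.2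
  let e : Basis (Fin nk ⊕ Fin m) ℝ V := Basis.mk ha.1 hsp.ge
  have he : ∀ i, e i = Sum.elim k a i := fun i => Basis.mk_apply _ _ i
  have ck := hk.finrank
  have ca := ha.finrank
  rw [rat_iff.1 hG] at ck
  rw [hL.2, finrank_top] at ca
  simp only [Fintype.card_fin, Fintype.card_sum] at ck ca
  -- the dual basis
  let d : Fin nk ⊕ Fin m → V := fun i =>
    (InnerProductSpace.toDual ℝ V).symm (LinearMap.toContinuousLinearMap (e.coord i))
  have hd : ∀ i j, inner ℝ (d i) (e j) = if i = j then (1 : ℝ) else 0 := by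
    intro i j
    simp only [d, InnerProductSpace.toDual_symm_apply]
    simp [Finsupp.single_apply, eq_comm]
  have hdli : LinearIndependent ℝ d := by
    rw [Fintype.linearIndependent_iff]
    intro g hg i
    have : inner ℝ (∑ j, g j • d j) (e i) = (0 : ℝ) := by rw [hg, inner_zero_left]
    rw [sum_inner] at this
    simp only [real_inner_smul_left, hd, mul_ite, mul_one, mul_zero, Finset.sum_ite_eq',
      Finset.mem_univ, if_true] at this
    exact this
  have hexp : ∀ y : V, y = ∑ i, (inner ℝ (e i) y : ℝ) • d i := by
    intro y
    have hl : (innerₛₗ ℝ y : V →ₗ[ℝ] ℝ) = innerₛₗ ℝ (∑ i, (inner ℝ (e i) y : ℝ) • d i) := by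
      refine e.ext fun i => ?_
      rw [innerₛₗ_apply_apply, innerₛₗ_apply_apply, sum_inner]
      simp only [real_inner_smul_left, hd, mul_ite, mul_one, mul_zero, Finset.sum_ite_eq',
        Finset.mem_univ, if_true]
      exact real_inner_comm _ _
    refine ext_inner_right ℝ fun z => ?_
    exact LinearMap.congr_fun hl z
  have heL : ∀ i, e i ∈ L := fun i => by
    have : Sum.elim k a i ∈ Submodule.span ℤ (Set.range (Sum.elim k a)) :=
      Submodule.subset_span ⟨i, rfl⟩
    rw [ha.2] at this
    rw [he]; exact this
  have hkG : ∀ i, k i ∈ cap L G := fun i => hk.2 ▸ Submodule.subset_span ⟨i, rfl⟩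
  have hdG : ∀ i, d (Sum.inr i) ∈ Gᗮ := by
    intro i
    have hG' : Submodule.span ℝ (Set.range k) = G := hk.spanR.trans hG
    rw [Submodule.mem_orthogonal]
    intro u hu
    rw [← hG'] at hu
    obtain ⟨c, rfl⟩ := (Submodule.mem_span_range_iff_exists_fun ℝ).1 hu
    rw [sum_inner]
    refine Finset.sum_eq_zero fun j _ => ?_
    have := hd (Sum.inr i) (Sum.inl j)
    rw [he] at this
    simp only [Sum.elim_inl] at this
    rw [real_inner_smul_left, real_inner_comm, this]
    simp
  have hdL : ∀ i, d i ∈ dualLat L := by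
    intro i x hx
    rw [← ha.2] at hx
    obtain ⟨c, rfl⟩ := (Submodule.mem_span_range_iff_exists_fun ℤ).1 hx
    refine ⟨c i, ?_⟩
    rw [sum_inner]
    simp only [← he, ← Int.cast_smul_eq_zsmul ℝ, real_inner_smul_left]
    simp only [fun j => real_inner_comm (d i) (e j), hd]
    simp
  have hB : IsB (fun i => d (Sum.inr i)) (cap (dualLat L) Gᗮ) := by
    refine ⟨hdli.comp _ Sum.inr_injective, le_antisymm ?_ ?_⟩
    · refine Submodule.span_le.2 ?_
      rintro _ ⟨i, rfl⟩
      exact ⟨hdL _, hdG i⟩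
    · rintro y ⟨hy1, hy2⟩
      rw [hexp y, Fintype.sum_sum_type]
      have z : ∀ i, inner ℝ (e (Sum.inl i)) y = (0 : ℝ) := by
        intro i
        rw [he]
        exact (Submodule.mem_orthogonal _ _).1 hy2 _ (hkG i).2
      simp only [z, zero_smul, Finset.sum_const_zero, zero_add]
      refine Submodule.sum_mem _ fun i _ => ?_
      obtain ⟨n, hn⟩ := hy1 _ (heL (Sum.inr i))
      rw [hn, Int.cast_smul_eq_zsmul]
      exact Submodule.smul_mem _ _ (Submodule.subset_span ⟨i, rfl⟩)
  refine ⟨m, _, hB, by omega, ?_⟩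
  have hpm : ∀ i, pr G (a i) ∈ Gᗮ := fun i => Gᗮ.starProjection_apply_mem _
  have hg := gram_dual Gᗮ (fun i => pr G (a i)) (fun i => d (Sum.inr i)) (by
      apply Submodule.eq_of_le_of_finrank_eq
      · refine Submodule.span_le.2 ?_
        rintro _ ⟨i, rfl⟩; exact hpm i
      · have h1 := finrank_span_eq_card hp.1
        have h2 := G.finrank_add_finrank_orthogonal
        rw [h1, Fintype.card_fin]
        omega) hdG (by
      intro i j
      have h1 : inner ℝ (d (Sum.inr i)) (a j - pr G (a j)) = (0 : ℝ) :=
        Submodule.inner_left_of_mem_orthogonal (sub_pr_mem G (a j)) (hdG i)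
      have h2 := hd (Sum.inr i) (Sum.inr j)
      rw [he] at h2
      simp only [Sum.elim_inr, Sum.inr.injEq] at h2
      rw [inner_sub_right, h2] at h1
      linarith)
  rw [← hB.covol_sq, ← hp.covol_sq] at hg
  rw [hcov]
  linear_combination covol (cap L G) ^ 2 * hg

end Dual

section Fin
variable {V : Type*} [NormedAddCommGroup V] [InnerProductSpace ℝ V] [FiniteDimensional ℝ V]

/-- the duality on subspaces -/
def sg (τ : V →ₗ[ℝ] V) (G : Submodule ℝ V) : Submodule ℝ V := (G.map τ)ᗮ

lemma sim_inj {τ : V →ₗ[ℝ] V} {α : ℝ} (hα : 0 < α)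
    (hτ : ∀ x y : V, (inner ℝ (τ x) (τ y) : ℝ) = α * inner ℝ x y) : Function.Injective τ := by
  rw [injective_iff_map_eq_zero]
  intro x hx
  have := hτ x x
  rw [hx, inner_zero_left] at this
  rcases mul_eq_zero.1 this.symm with h | h
  · exact absurd h hα.ne'
  · exact inner_self_eq_zero.1 h

lemma form_symm {τ : V →ₗ[ℝ] V}
    (hform : (∀ x y, bform τ x y = bform τ y x) ∨ (∀ x, bform τ x x = 0)) (x y : V)
    (h : inner ℝ (τ x) y = (0 : ℝ)) : inner ℝ (τ y) x = (0 : ℝ) := by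
  rcases hform with h1 | h1
  · have := h1 x y
    unfold bform at this
    rw [← this, h]
  · have h2 := h1 (x + y)
    have h3 := h1 x
    have h4 := h1 y
    unfold bform at h2 h3 h4
    rw [map_add, inner_add_left, inner_add_right, inner_add_right] at h2
    linarith

lemma mem_sg {τ : V →ₗ[ℝ] V} {G : Submodule ℝ V} {x : V} :
    x ∈ sg τ G ↔ ∀ y ∈ G, inner ℝ (τ y) x = (0 : ℝ) := by
  unfold sg
  rw [Submodule.mem_orthogonal]
  constructor
  · intro h y hy
    exact h _ ⟨y, hy, rfl⟩
  · rintro h _ ⟨y, hy, rfl⟩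
    exact h y hy

lemma finrank_sg {τ : V →ₗ[ℝ] V} (hinj : Function.Injective τ) (G : Submodule ℝ V) :
    finrank ℝ (sg τ G) + finrank ℝ G = finrank ℝ V := by
  have := (G.map τ).finrank_add_finrank_orthogonal
  rw [← (Submodule.equivMapOfInjective τ hinj G).finrank_eq] at this
  unfold sg
  omega

lemma sg_sg {τ : V →ₗ[ℝ] V} (hinj : Function.Injective τ)
    (hs : ∀ x y : V, inner ℝ (τ x) y = (0 : ℝ) → inner ℝ (τ y) x = (0 : ℝ)) (G : Submodule ℝ V) :
    sg τ (sg τ G) = G := by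
  symm
  apply Submodule.eq_of_le_of_finrank_eq
  · intro x hx
    rw [mem_sg]
    intro y hy
    exact hs _ _ (mem_sg.1 hy x hx)
  · have h1 := finrank_sg hinj G
    have h2 := finrank_sg hinj (sg τ G)
    omega

lemma sg_anti (τ : V →ₗ[ℝ] V) (F G : Submodule ℝ V) (h : F ≤ G) : sg τ G ≤ sg τ F :=
  Submodule.orthogonal_le (Submodule.map_mono h)

lemma sg_lat {L : Submodule ℤ V} (hL : IsLat L) {τ : V →ₗ[ℝ] V} {α : ℝ} (hα : 0 < α)
    (hτ : ∀ x y : V, (inner ℝ (τ x) (τ y) : ℝ) = α * inner ℝ x y)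
    (hd : L.map (τ.restrictScalars ℤ) = dualLat L)
    (hs : ∀ x y : V, inner ℝ (τ x) y = (0 : ℝ) → inner ℝ (τ y) x = (0 : ℝ))
    {G : Submodule ℝ V} (hG : IsRational L G) :
    IsRational L (sg τ G) ∧ lc L (sg τ G) = lc L G + (Real.log α / 2) * finrank ℝ G +
      (- Real.log (covol L) - finrank ℝ V * Real.log α / 2) := by
  have hinj := sim_inj hα hτ
  have hmap : (cap L (sg τ G)).map (τ.restrictScalars ℤ) = cap (dualLat L) Gᗮ := by
    ext z
    simp only [Submodule.mem_map, mem_cap, ← hd]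
    constructor
    · rintro ⟨x, ⟨h1, h2⟩, rfl⟩
      refine ⟨⟨x, h1, rfl⟩, (Submodule.mem_orthogonal _ _).2 fun u hu => ?_⟩
      rw [real_inner_comm]
      exact hs _ _ (mem_sg.1 h2 u hu)
    · rintro ⟨⟨x, h1, rfl⟩, h2⟩
      refine ⟨x, ⟨h1, mem_sg.2 fun y hy => ?_⟩, rfl⟩
      apply hs
      have := (Submodule.mem_orthogonal _ _).1 h2 y hy
      rw [real_inner_comm] at this
      exact this
  obtain ⟨m, v, hv⟩ := exists_isB hL.1 (M := cap L (sg τ G)) inf_le_left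
  obtain ⟨n0, v0, hv0⟩ := exists_isB hL.1 (M := L) le_rfl
  obtain ⟨n1, v1, hv1⟩ := exists_isB hL.1 (M := cap L G) inf_le_left
  obtain ⟨hb, hcov⟩ := hv.covol_map τ α hα hτ
  rw [hmap] at hb hcov
  obtain ⟨m', w, hw, hm, hc⟩ := dual_covol hL hG
  have e1 := hb.finrank
  have e2 := hw.finrank
  have e3 := hv.finrank
  have e4 := finrank_sg hinj G
  simp only [Fintype.card_fin] at e1 e2 e3 hcov
  constructor
  · rw [rat_iff]
    apply Submodule.eq_of_le_of_finrank_eq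
    · exact Submodule.span_le.2 fun x hx => hx.2
    · omega
  · rw [hcov] at hc
    have p0 := hv0.covol_pos
    have p1 := hv1.covol_pos
    have p2 := hv.covol_pos
    have h3 := congrArg Real.log hc
    rw [Real.log_mul (by positivity) (by positivity), Real.log_mul (by positivity) (by positivity),
      Real.log_pow, Real.log_pow, Real.log_pow, Real.log_pow] at h3
    have hmm : (m : ℝ) = finrank ℝ V - finrank ℝ G := by
      have : m + finrank ℝ G = finrank ℝ V := by omega
      rw [← this]; push_cast; ring
    rw [hmm] at h3
    unfold lc
    push_cast at h3
    linear_combination h3 / 2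

end Fin

lemma flag_dual {E : Type*} [NormedAddCommGroup E] [InnerProductSpace ℝ E]
    [FiniteDimensional ℝ E] (L : Submodule ℤ E) (hL : IsLat L)
    (τ : E →ₗ[ℝ] E) (hiso : IsIsodual L τ)
    (hform : (∀ x y, bform τ x y = bform τ y x) ∨ (∀ x, bform τ x x = 0))
    {ℓ : ℕ} (C : Fin (ℓ + 1) → Submodule ℝ E) (hC : IsGSFlag L C) (i : Fin (ℓ + 1)) :
    sg τ (C i) = C i.rev := by
  obtain ⟨⟨α, hα, hτ⟩, hd⟩ := hiso
  obtain ⟨h0, h1, hlt, hrat, hss, hred⟩ := hC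
  have hs := form_symm hform
  have hinj := sim_inj hα hτ
  let D : ℕ → Submodule ℝ E := fun n => C ⟨min n ℓ, by omega⟩
  have hD : ∀ n (hn : n ≤ ℓ), D n = C ⟨n, by omega⟩ := by
    intro n hn
    simp only [D]
    congr 2
    omega
  have hD1 : ∀ n (hn : n < ℓ), D n = C (Fin.castSucc ⟨n, hn⟩) := fun n hn => hD n hn.le
  have hD2 : ∀ n (hn : n < ℓ), D (n + 1) = C (Fin.succ ⟨n, hn⟩) := fun n hn => hD (n + 1) hn
  have hmono : StrictMono C := Fin.strictMono_iff_lt_succ.2 hlt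
  have hDlt : ∀ i j, i < j → j ≤ ℓ → D i < D j := by
    intro i j hij hj
    rw [hD i (by omega), hD j hj]
    exact hmono hij
  have hDrat : ∀ n, IsRational L (D n) := fun n => hrat _
  let μ : ℕ → ℝ := fun n => Real.log (redH (succQuot L (D n) (D (n + 1))))
  have hHN : HN (IsRational L) (lc L) ℓ D μ :=
    { inf := fun F G hF hG => rat_inf hL.1 hF hG
      sup := fun F G hF hG => rat_sup hF hG
      sub := fun F G hF hG => lc_sub hL.1 hF hG
      bot := (hD 0 (Nat.zero_le _)).trans h0
      top := (hD ℓ le_rfl).trans h1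
      mono := fun i hi => (hDlt i (i + 1) (Nat.lt_succ_self i) hi).le
      rat := fun i _ => hDrat i
      ge := by
        intro i hi G hG hl hr
        refine ss_ge hL.1 hl hr (hDrat i) hG ?_
        rw [hD1 i hi, hD2 i hi]
        exact hss _
      eq := by
        intro i hi
        have hl := hDlt i (i + 1) (Nat.lt_succ_self i) hi
        have hdim : (0 : ℝ) < (finrank ℝ (D (i + 1)) : ℝ) - finrank ℝ (D i) := by
          rw [sub_pos]; exact_mod_cast Submodule.finrank_lt_finrank_of_lt hl
        simp only [μ]
        rw [(log_redH hL.1 hl.le (hDrat i)).2]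
        field_simp }
  have hμ : ∀ i j, i < j → j < ℓ → μ i < μ j := by
    intro i j hij hj
    simp only [μ]
    apply Real.log_lt_log
    · exact (log_redH hL.1 (hDlt i (i + 1) (Nat.lt_succ_self i) (by omega)).le (hDrat i)).1
    · rw [hD1 i (by omega), hD2 i (by omega), hD1 j hj, hD2 j hj]
      exact hred _ _ hij
  have := hHN.dual hμ hDlt (sg τ) (fun G hG => (sg_lat hL hα hτ hd hs hG).1) (sg_sg hinj hs)
    (sg_anti τ) (finrank_sg hinj) _ _ (fun G hG => (sg_lat hL hα hτ hd hs hG).2) i (by omega)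
  rw [hD i (by omega), hD _ (by omega)] at this
  refine Eq.trans this ?_
  congr 1
  ext
  simp only [Fin.val_rev]
  omega

/-- For an isodual Euclidean lattice `(E, L, τ)` with `b_τ` symmetric or
alternating and a GS-flag `(Eᵢ)`: `τ(Eᵢ) = (E_{ℓ-i})ᗮ`; `Eᵢ` is totally isotropic for `2i ≤ ℓ`
and co-isotropic for `2i ≥ ℓ`. -/
theorem statement6 {E : Type*} [NormedAddCommGroup E] [InnerProductSpace ℝ E]
    [FiniteDimensional ℝ E] (L : Submodule ℤ E) (hL : IsLat L)
    (τ : E →ₗ[ℝ] E) (hiso : IsIsodual L τ)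
    (hform : (∀ x y, bform τ x y = bform τ y x) ∨ (∀ x, bform τ x x = 0))
    {ℓ : ℕ} (C : Fin (ℓ + 1) → Submodule ℝ E) (hC : IsGSFlag L C) :
    (∀ i : Fin (ℓ + 1), (C i).map τ = (C i.rev)ᗮ) ∧
    (∀ i : Fin (ℓ + 1), 2 * (i : ℕ) ≤ ℓ → ∀ x ∈ C i, ∀ y ∈ C i, bform τ x y = 0) ∧
    (∀ i : Fin (ℓ + 1), ℓ ≤ 2 * (i : ℕ) →
      ∀ x : E, (∀ y ∈ C i, bform τ x y = 0) → x ∈ C i) := by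
  have hσ := flag_dual L hL τ hiso hform C hC
  have hmono : StrictMono C := Fin.strictMono_iff_lt_succ.2 hC.2.2.1
  have hs := form_symm hform
  refine ⟨fun i => ?_, fun i hi x hx y hy => ?_, fun i hi x hx => ?_⟩
  · rw [← hσ i]
    unfold sg
    rw [Submodule.orthogonal_orthogonal]
  · have hle : C i ≤ C i.rev := hmono.monotone (by rw [Fin.le_def, Fin.val_rev]; omega)
    have := hle hy
    rw [← hσ i, mem_sg] at this
    exact this x hx
  · have hle : C i.rev ≤ C i := hmono.monotone (by rw [Fin.le_def, Fin.val_rev]; omega)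
    apply hle
    rw [← hσ i, mem_sg]
    intro y hy
    exact hs _ _ (hx y hy)

end EucLat
end
end

section
/- Let (E, L, τ) be an orthogonal isodual Euclidean lattice (i.e. b_τ is symmetric). If (E, L) is unstable, then the dimension of its destabilizing subspace is at most (dim E − |s(b_τ)|)/2, where s(b_τ) is the signature of b_τ. In particular, if b_τ is definite then (E, L) is semistable. -/
open Module

noncomputable section

namespace EucLat

variable {E : Type*} [NormedAddCommGroup E] [InnerProductSpace ℝ E]

open Matrix in
theorem gram_transform {ι κ : Type*} [Fintype ι] [Fintype κ] (U : Matrix κ ι ℝ) (w : ι → E)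
    (v : κ → E) (h : ∀ i, v i = ∑ j, U i j • w j) : gram ℝ v = U * gram ℝ w * Uᵀ := by
  ext i j
  simp only [gram_apply, h, Matrix.mul_apply, Matrix.transpose_apply, sum_inner, inner_sum,
    real_inner_smul_left, real_inner_smul_right, Finset.sum_mul]
  refine Finset.sum_congr rfl fun a _ => Finset.sum_congr rfl fun b _ => by ring

open Matrix in
theorem covol_eq_s8 {ι : Type*} [Fintype ι] [DecidableEq ι] (M : Submodule ℤ E)
    (c : Basis ι ℤ M) : covol M = Real.sqrt (gram ℝ (fun i => (c i : E))).det := by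
  have h : ∃ n : ℕ, Nonempty (Basis (Fin n) ℤ M) :=
    ⟨_, ⟨c.reindex (Fintype.equivFin ι)⟩⟩
  unfold covol
  rw [dif_pos h]
  set b := h.choose_spec.some with hb
  congr 1
  change (gram ℝ (fun i => (b i : E))).det = _
  have e : ι ≃ Fin h.choose := c.indexEquiv b
  set c' := c.reindex e with hc'
  have h1 : (gram ℝ (fun i => (c' i : E))).det = (gram ℝ (fun i => (c i : E))).det := by
    rw [← Matrix.det_submatrix_equiv_self e.symm (gram ℝ (fun i => (c i : E)))]
    congr 1
    ext i j
    simp [hc', gram_apply]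
  rw [← h1]
  have h2 : ∀ i, (b i : E) = ∑ j, (((c'.toMatrix b)ᵀ.map (Int.cast : ℤ → ℝ)) i j) • (c' j : E) := by
    intro i
    have := c'.sum_toMatrix_smul_self b i
    have h3 := congrArg (fun x : M => (x : E)) this
    simp only [Submodule.coe_sum, Submodule.coe_smul] at h3
    rw [← h3]
    refine Finset.sum_congr rfl fun j _ => ?_
    simp [Int.cast_smul_eq_zsmul]
  have hd : (c'.toMatrix b).det * (c'.toMatrix b).det = 1 := by
    have : IsUnit (c'.toMatrix b).det := by
      have := c'.toMatrix_mul_toMatrix_flip b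
      exact (Matrix.isUnit_iff_isUnit_det _).1 (IsUnit.of_mul_eq_one _ this)
    rcases Int.isUnit_iff.1 this with h | h <;> simp [h]
  rw [gram_transform _ _ _ h2, Matrix.det_mul, Matrix.det_mul, Matrix.det_transpose]
  have h4 : ((c'.toMatrix b)ᵀ.map (Int.cast : ℤ → ℝ)).det = ((c'.toMatrix b).det : ℝ) := by
    rw [← Matrix.det_transpose (c'.toMatrix b)]
    exact ((Int.castRingHom ℝ).map_det _).symm
  rw [h4]
  have hd' : ((c'.toMatrix b).det : ℝ) * ((c'.toMatrix b).det : ℝ) = 1 := by exact_mod_cast hd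
  linear_combination (gram ℝ (fun i => (c' i : E))).det * hd'

theorem abs_det_le {V : Type*} [NormedAddCommGroup V] [InnerProductSpace ℝ V]
    [FiniteDimensional ℝ V] (T : V →ₗ[ℝ] V) (hT : T.IsSymmetric) (c : ℝ)
    (h : ∀ x, |inner ℝ (T x) x| ≤ c * ‖x‖ ^ 2) : |LinearMap.det T| ≤ c ^ finrank ℝ V := by
  rw [hT.det_eq_prod_eigenvalues rfl, RCLike.ofReal_real_eq_id, Finset.abs_prod]
  calc _ ≤ ∏ i : Fin (finrank ℝ V), c := by
        refine Finset.prod_le_prod (fun _ _ => abs_nonneg _) fun i _ => ?_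
        have h1 := h (hT.eigenvectorBasis rfl i)
        rw [hT.apply_eigenvectorBasis, real_inner_smul_left, real_inner_self_eq_norm_sq] at h1
        simpa using h1
    _ = _ := by simp

open Matrix in
theorem det_form_le [FiniteDimensional ℝ E] {κ : Type*} [Fintype κ] [DecidableEq κ]
    (u : κ → E) (hu : LinearIndependent ℝ u)
    (τ : E →ₗ[ℝ] E) (hτ : τ.IsSymmetric) (c : ℝ) (h : ∀ x, |inner ℝ (τ x) x| ≤ c * ‖x‖ ^ 2) :
    |(Matrix.of fun i j => (inner ℝ (τ (u i)) (u j) : ℝ)).det| ≤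
      c ^ Fintype.card κ * (gram ℝ u).det := by
  set W := Submodule.span ℝ (Set.range u) with hW
  let β : Basis κ ℝ W := Basis.span hu
  have hβ : ∀ i, (β i : E) = u i := fun i => congrArg Subtype.val (Basis.span_apply hu i)
  let T : W →ₗ[ℝ] W := (W.orthogonalProjectionOnto : E →ₗ[ℝ] W) ∘ₗ τ ∘ₗ W.subtype
  have hTin : ∀ x y : W, inner ℝ (T x) y = (inner ℝ (τ x) (y : E) : ℝ) := by
    intro x y
    simp [T]
  have hT : T.IsSymmetric := by
    intro x y
    rw [hTin, real_inner_comm (T y) x, hTin, hτ, real_inner_comm]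
  have h1 := abs_det_le T hT c (by
    intro x
    rw [hTin]; exact h x)
  have hfr : finrank ℝ W = Fintype.card κ := finrank_eq_card_basis β
  have hB : (Matrix.of fun i j => (inner ℝ (τ (u i)) (u j) : ℝ)) =
      (LinearMap.toMatrix β β T)ᵀ * gram ℝ u := by
    ext i j
    have h2 : T (β i) = ∑ l, LinearMap.toMatrix β β T l i • β l := by
      simp only [LinearMap.toMatrix_apply]
      exact (β.sum_repr _).symm
    rw [Matrix.of_apply, ← hβ i, ← hβ j, ← hTin, h2, sum_inner, Matrix.mul_apply]
    refine Finset.sum_congr rfl fun l _ => ?_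
    rw [real_inner_smul_left, Matrix.transpose_apply, gram_apply, Submodule.coe_inner, hβ, hβ]
  rw [hB, Matrix.det_mul, Matrix.det_transpose, LinearMap.det_toMatrix, abs_mul,
    abs_of_pos (posDef_gram_of_linearIndependent hu).det_pos, ← hfr]
  exact mul_le_mul_of_nonneg_right h1 (posDef_gram_of_linearIndependent hu).det_pos.le

open Matrix in
theorem gram_split {ι : Type*} [Fintype ι] [DecidableEq ι] (p : ι → Prop) [DecidablePred p]
    (w : ι → E) (u : {i // ¬ p i} → E)
    (hu : ∀ i, u i - w i ∈ Submodule.span ℝ (Set.range fun i : {i // p i} => w i))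
    (hperp : ∀ i (j : {i // p i}), inner ℝ (u i) (w j) = (0 : ℝ)) :
    (gram ℝ w).det = (gram ℝ fun i : {i // p i} => w i).det * (gram ℝ u).det := by
  have hC : ∀ i, ∃ c : {i // p i} → ℝ, ∑ j, c j • w j = u i - w i := by
    intro i
    exact (Submodule.mem_span_range_iff_exists_fun ℝ).1 (hu i)
  choose C hC using hC
  let v : ι → E := fun i => if h : p i then w i else u ⟨i, h⟩
  let N : Matrix ι ι ℝ := fun i j => if hi : p i then 0 else if hj : p j then C ⟨i, hi⟩ ⟨j, hj⟩ else 0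
  let U : Matrix ι ι ℝ := 1 + N
  have hU : ∀ i j, U i j = (1 : Matrix ι ι ℝ) i j + N i j := fun _ _ => rfl
  have hN1 : ∀ i j, p i → N i j = 0 := fun i j hi => by simp [N, hi]
  have hN2 : ∀ i j, ¬ p j → N i j = 0 := fun i j hi => by simp [N, hi]
  have hv : ∀ i, v i = ∑ j, U i j • w j := by
    intro i
    have h1 : ∑ j, U i j • w j = w i + ∑ j, N i j • w j := by
      simp [U, add_smul, Finset.sum_add_distrib, Matrix.one_apply]
    rw [h1]
    by_cases hi : p i
    · simp [v, N, hi]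
    · have h2 : ∑ j, N i j • w j = ∑ j : {i // p i}, C ⟨i, hi⟩ j • w j := by
        rw [← Fintype.sum_subtype_add_sum_subtype p]
        have h3 : ∑ j : {x // ¬ p x}, N i j • w j = 0 :=
          Finset.sum_eq_zero fun j _ => by simp [N, j.2]
        rw [h3, add_zero]
        refine Finset.sum_congr rfl fun j _ => by simp [N, j.2, hi]
      rw [h2, hC]
      simp [v, hi]
  have hdU : U.det = 1 := by
    rw [Matrix.twoBlockTriangular_det' U p]
    · have h1 : toSquareBlockProp U p = 1 := by
        ext i j
        simp [toSquareBlockProp_def, hU, hN1 _ _ i.2, Matrix.one_apply, Subtype.ext_iff]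
      have h2 : (toSquareBlockProp U fun i => ¬ p i) = 1 := by
        ext i j
        simp [toSquareBlockProp_def, hU, hN2 _ _ j.2, Matrix.one_apply, Subtype.ext_iff]
      rw [h1, h2]; simp
    · intro i hi j hj
      have : i ≠ j := fun h => hj (h ▸ hi)
      simp [hU, hN1 _ _ hi, this]
  have h1 : (gram ℝ v).det = (gram ℝ w).det := by
    rw [gram_transform U w v hv, Matrix.det_mul, Matrix.det_mul, Matrix.det_transpose, hdU]; ring
  rw [← h1, Matrix.twoBlockTriangular_det (gram ℝ v) p]
  · congr 2
    · ext i j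
      simp [toSquareBlockProp_def, v, i.2, j.2]
    · ext i j
      simp [toSquareBlockProp_def, v, i.2, j.2]
  · intro i hi j hj
    simpa [v, hi, hj] using hperp ⟨i, hi⟩ ⟨j, hj⟩

theorem latIn_discrete (L : Submodule ℤ E) (hL : DiscreteTopology L) (F : Submodule ℝ E) :
    DiscreteTopology (latIn L F) :=
  ZLattice.comap_discreteTopology ℝ L (e := F.subtype) continuous_subtype_val
    Subtype.val_injective

theorem latIn_span (L : Submodule ℤ E) (F : Submodule ℝ E) (hF : IsRational L F) :
    Submodule.span ℝ (latIn L F : Set F) = ⊤ := by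
  apply Submodule.map_injective_of_injective F.injective_subtype
  rw [Submodule.map_span, Submodule.map_top, Submodule.range_subtype]
  have : F.subtype '' (latIn L F : Set F) = (L : Set E) ∩ F := by
    ext x
    constructor
    · rintro ⟨y, hy, rfl⟩
      exact ⟨hy, y.2⟩
    · rintro ⟨h1, h2⟩
      exact ⟨⟨x, h2⟩, h1, rfl⟩
  rw [this]
  exact hF

open Matrix in
theorem key [FiniteDimensional ℝ E] (L : Submodule ℤ E) (hL : IsLat L)
    (τ : E →ₗ[ℝ] E) (hτ : τ.IsSymmetric) (c : ℝ)
    (hc : ∀ x, |inner ℝ (τ x) x| ≤ c * ‖x‖ ^ 2) (hc0 : 0 < c)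
    (hint : ∀ x ∈ L, ∀ y ∈ L, ∃ n : ℤ, (inner ℝ (τ x) y : ℝ) = n)
    (F : Submodule ℝ E) (hF : IsRational L F) :
    ∃ D : Submodule ℝ E, D ≤ F ∧ IsRational L D ∧
      (∀ x ∈ D, ∀ y ∈ F, (inner ℝ (τ x) y : ℝ) = 0) ∧
      0 < covol (latIn L D) ∧ 0 < covol (latIn L F) ∧
      covol (latIn L D) ^ 2 * c ^ finrank ℝ D ≤ covol (latIn L F) ^ 2 * c ^ finrank ℝ F := by
  classical
  have hd := latIn_discrete L hL.1 F
  have hz : IsZLattice ℝ (latIn L F) := ⟨latIn_span L F hF⟩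
  set M := latIn L F with hM
  have hML : ∀ x : M, ((x : F) : E) ∈ L := fun x => x.2
  -- the radical
  let R : Submodule ℤ M :=
    { carrier := {x | ∀ y : M, (inner ℝ (τ ((x : F) : E)) ((y : F) : E) : ℝ) = 0}
      zero_mem' := by intro y; simp
      add_mem' := by
        intro a b ha hb y
        have h1 := ha y
        have h2 := hb y
        simp [inner_add_left, h1, h2]
      smul_mem' := by
        intro z a ha y
        have h1 := ha y
        have : (((z • a : M) : F) : E) = (z : ℝ) • ((a : F) : E) := by
          simp [Int.cast_smul_eq_zsmul]
        rw [this, map_smul, real_inner_smul_left, h1, mul_zero] }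
  have hRmem : ∀ x : M, x ∈ R ↔ ∀ y : M, (inner ℝ (τ ((x : F) : E)) ((y : F) : E) : ℝ) = 0 :=
    fun x => Iff.rfl
  have : Module.Free ℤ M := ZLattice.module_free ℝ M
  have : Module.Finite ℤ M := ZLattice.module_finite ℝ M
  obtain ⟨e, snf⟩ := R.smithNormalForm (Module.Free.chooseBasis ℤ M)
  set ι := Module.Free.ChooseBasisIndex ℤ M
  set β : Basis ι ℤ M := snf.bM with hβ
  have hsat : ∀ (z : ℤ) (x : M), z ≠ 0 → z • x ∈ R → x ∈ R := by
    intro z x hz h y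
    have h1 := h y
    have : (((z • x : M) : F) : E) = (z : ℝ) • ((x : F) : E) := by
      simp [Int.cast_smul_eq_zsmul]
    rw [this, map_smul, real_inner_smul_left] at h1
    exact (mul_eq_zero.1 h1).resolve_left (by exact_mod_cast hz)
  let p : ι → Prop := fun i => β i ∈ R
  have hpf : ∀ k, p (snf.f k) := by
    intro k
    refine hsat (snf.a k) _ ?_ ?_
    · intro h0
      have h1 := snf.snf k
      rw [h0, zero_smul] at h1
      exact snf.bN.ne_zero k (Subtype.ext h1)
    · rw [← snf.snf k]; exact (snf.bN k).2
  have hrepr : ∀ x ∈ R, ∀ i, ¬ p i → β.repr x i = 0 := by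
    intro x hx i hi
    refine snf.repr_eq_zero_of_notMem_range ⟨x, hx⟩ ?_
    rintro ⟨k, rfl⟩
    exact hi (hpf k)
  let w : ι → E := fun i => ((β i : F) : E)
  let βR : Basis ι ℝ F := β.ofZLatticeBasis ℝ M
  have hβR : ∀ i, (βR i : E) = w i := fun i => by simp [βR, w]
  have hwli : LinearIndependent ℝ w := by
    have := βR.linearIndependent.map' F.subtype F.ker_subtype
    have h1 : w = F.subtype ∘ βR := by ext i; simp [hβR]
    rw [h1]; exact this
  have hspanF : Submodule.span ℝ (Set.range w) = F := by
    have h1 := congrArg (Submodule.map F.subtype) βR.span_eq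
    rw [Submodule.map_span, Submodule.map_top, Submodule.range_subtype, ← Set.range_comp] at h1
    rw [← h1]
    congr 2
    ext i; simp [hβR]
  have hrad : ∀ i, p i → ∀ y ∈ F, (inner ℝ (τ (w i)) y : ℝ) = 0 := by
    intro i hi y hy
    rw [← hspanF] at hy
    induction hy using Submodule.span_induction with
    | mem x h => obtain ⟨j, rfl⟩ := h; exact hi (β j)
    | zero => simp
    | add x y _ _ hx hy => rw [inner_add_right, hx, hy, add_zero]
    | smul a x _ hx => rw [real_inner_smul_right, hx, mul_zero]
  let r : {i // p i} → E := fun i => w i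
  let D := Submodule.span ℝ (Set.range r)
  have hrli : LinearIndependent ℝ r := hwli.comp _ Subtype.val_injective
  have hwF : ∀ i, w i ∈ F := fun i => (β i : F).2
  have hwL : ∀ i, w i ∈ L := fun i => hML (β i)
  have hDF : D ≤ F := Submodule.span_le.2 (by rintro _ ⟨i, rfl⟩; exact hwF i)
  have hDrad : ∀ x ∈ D, ∀ y ∈ F, (inner ℝ (τ x) y : ℝ) = 0 := by
    intro x hx y hy
    induction hx using Submodule.span_induction with
    | mem x h => obtain ⟨j, rfl⟩ := h; exact hrad j j.2 y hy
    | zero => simp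
    | add x y _ _ hx hy => rw [map_add, inner_add_left, hx, hy, add_zero]
    | smul a x _ hx => rw [map_smul, real_inner_smul_left, hx, mul_zero]
  have hrD : ∀ i, r i ∈ D := fun i => Submodule.subset_span ⟨i, rfl⟩
  have hDrat : IsRational L D := by
    refine le_antisymm (Submodule.span_le.2 fun x hx => hx.2) ?_
    refine Submodule.span_mono ?_
    rintro _ ⟨i, rfl⟩
    exact ⟨hwL i, hrD i⟩
  -- basis of `latIn L D`
  let rr : {i // p i} → latIn L D := fun i => ⟨⟨r i, hrD i⟩, hwL i⟩
  have hrrli : LinearIndependent ℤ rr := by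
    let g : latIn L D →ₗ[ℤ] E := (D.subtype.restrictScalars ℤ) ∘ₗ (latIn L D).subtype
    refine LinearIndependent.of_comp g ?_
    exact hrli.restrict_scalars' ℤ
  have hrrsp : ⊤ ≤ Submodule.span ℤ (Set.range rr) := by
    intro x _
    let y : M := ⟨⟨((x : D) : E), hDF (x : D).2⟩, x.2⟩
    have hyR : y ∈ R := fun z => hDrad _ (x : D).2 _ (z : F).2
    have h1 := β.sum_repr y
    have h2 : x = ∑ i : {i // p i}, β.repr y i • rr i := by
      have h3 := congrArg (fun t : M => ((t : F) : E)) h1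
      apply Subtype.ext
      apply Subtype.ext
      simp only [Submodule.coe_sum, Submodule.coe_smul] at h3 ⊢
      rw [← Fintype.sum_subtype_add_sum_subtype p] at h3
      rw [Finset.sum_eq_zero (s := (Finset.univ : Finset {i // ¬ p i}))
        (fun i _ => by rw [hrepr y hyR i i.2, zero_smul]; rfl), add_zero] at h3
      exact h3.symm
    rw [h2]
    exact Submodule.sum_mem _ fun i _ => Submodule.smul_mem _ _ (Submodule.subset_span ⟨i, rfl⟩)
  let γ : Basis {i // p i} ℤ (latIn L D) := Basis.mk hrrli hrrsp
  have hcD : covol (latIn L D) = Real.sqrt (gram ℝ r).det := by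
    rw [covol_eq_s8 _ γ]
    congr 2
    ext i j
    simp [gram_apply, γ, rr, Submodule.coe_inner]
  have hcF : covol (latIn L F) = Real.sqrt (gram ℝ w).det := by
    rw [covol_eq_s8 _ β]
    congr 2
  have hfD : finrank ℝ D = Fintype.card {i // p i} := finrank_span_eq_card hrli
  have hfF : finrank ℝ F = Fintype.card ι := finrank_eq_card_basis βR
  -- projections
  let u : {i // ¬ p i} → E := fun i => w i - D.starProjection (w i)
  have huD : ∀ i : {i // ¬ p i}, u i - w i ∈ D := by
    intro i
    have : u i - w i = - D.starProjection (w i) := by simp [u]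
    rw [this]
    exact D.neg_mem (D.starProjection_apply_mem _)
  have hperp : ∀ i (j : {i // p i}), inner ℝ (u i) (w j) = (0 : ℝ) := by
    intro i j
    exact D.starProjection_inner_eq_zero (w i) (r j) (hrD j)
  have hsplit := gram_split p w u huD hperp
  have hpw := (posDef_gram_of_linearIndependent hwli).det_pos
  have hpr := (posDef_gram_of_linearIndependent hrli).det_pos
  have huli : LinearIndependent ℝ u := by
    rw [← det_gram_ne_zero_iff_linearIndependent (𝕜 := ℝ)]
    intro h0
    rw [h0, mul_zero] at hsplit
    exact hpw.ne' hsplit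
  -- integrality
  choose Bz hBz using fun i j : {i // ¬ p i} => hint (w i) (hwL i) (w j) (hwL j)
  have hBu : ∀ i j, (inner ℝ (τ (u i)) (u j) : ℝ) = Bz i j := by
    intro i j
    rw [← hBz]
    have hi : u i = w i + (u i - w i) := by abel
    have hj : u j = w j + (u j - w j) := by abel
    have hujF : u j ∈ F := by rw [hj]; exact F.add_mem (hwF j) (hDF (huD j))
    rw [hi, map_add, inner_add_left, hDrad _ (huD i) _ hujF, add_zero, hj, inner_add_right,
      hτ (w i) (u j - w j), real_inner_comm (τ (u j - w j)) (w i), hDrad _ (huD j) _ (hwF i), add_zero]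
  have hdetz : (Matrix.of Bz).det ≠ 0 := by
    intro h0
    obtain ⟨v, hv0, hv⟩ := Matrix.exists_vecMul_eq_zero_iff.2 h0
    apply hv0
    let x : M := ∑ i, v i • β (i : ι)
    have hx : ((x : F) : E) = ∑ i, (v i : ℝ) • w i := by
      simp [x, w, Int.cast_smul_eq_zsmul]
    have hxF : ((x : F) : E) ∈ F := (x : F).2
    have hxR : x ∈ R := by
      have key1 : ∀ j, (inner ℝ (τ ((x : F) : E)) (w j) : ℝ) = 0 := by
        intro j
        by_cases hj : p j
        · rw [hτ, real_inner_comm]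
          exact hrad j hj _ hxF
        · have h1 := congrFun hv ⟨j, hj⟩
          simp only [Matrix.vecMul, dotProduct, Matrix.of_apply, Pi.zero_apply] at h1
          rw [hx, map_sum, sum_inner]
          have h2 : ((∑ i, v i * Bz i ⟨j, hj⟩ : ℤ) : ℝ) = 0 := by exact_mod_cast h1
          push_cast at h2
          rw [← h2]
          refine Finset.sum_congr rfl fun i _ => ?_
          rw [map_smul, real_inner_smul_left, ← hBz]
      intro y
      have hy : ((y : F) : E) ∈ Submodule.span ℝ (Set.range w) := by
        rw [hspanF]; exact (y : F).2
      generalize ((y : F) : E) = y' at hy ⊢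
      induction hy using Submodule.span_induction with
      | mem x h => obtain ⟨j, rfl⟩ := h; exact key1 j
      | zero => simp
      | add x y _ _ hx hy => rw [inner_add_right, hx, hy, add_zero]
      | smul a x _ hx => rw [real_inner_smul_right, hx, mul_zero]
    ext i
    have h3 := hrepr x hxR i i.2
    have h4 : β.repr x i = v i := by
      simp only [x, map_sum, map_smul, Basis.repr_self, Finsupp.coe_finsetSum, Finset.sum_apply,
        Finsupp.smul_apply, Finsupp.single_apply, smul_eq_mul, mul_ite, mul_one, mul_zero]
      rw [Finset.sum_eq_single i]
      · simp
      · intro b _ hb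
        rw [if_neg]
        exact fun h => hb (Subtype.ext h)
      · simp
    rw [← h4, h3]; rfl
  have hB1 : (1 : ℝ) ≤ |(Matrix.of fun i j => (inner ℝ (τ (u i)) (u j) : ℝ)).det| := by
    have h1 : (Matrix.of fun i j => (inner ℝ (τ (u i)) (u j) : ℝ)).det
        = ((Matrix.of Bz).det : ℝ) := by
      have h2 : (Matrix.of fun i j => (inner ℝ (τ (u i)) (u j) : ℝ)) =
        (Int.castRingHom ℝ).mapMatrix (Matrix.of Bz) := by
        ext i j
        simp [hBu]
      rw [h2, ← RingHom.map_det]; rfl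
    rw [h1]
    exact_mod_cast Int.one_le_abs hdetz
  have hle := hB1.trans (det_form_le u huli τ hτ c hc)
  refine ⟨D, hDF, hDrat, hDrad, ?_, ?_, ?_⟩
  · rw [hcD]; exact Real.sqrt_pos.2 hpr
  · rw [hcF]; exact Real.sqrt_pos.2 hpw
  · rw [hcD, hcF, Real.sq_sqrt hpr.le, Real.sq_sqrt hpw.le, hsplit, hfD, hfF]
    have hcard : Fintype.card ι = Fintype.card {i // p i} + Fintype.card {i // ¬ p i} := by
      rw [Fintype.card_subtype_compl, Nat.add_sub_cancel' (Fintype.card_subtype_le p)]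
    rw [hcard, pow_add]
    have hpos : 0 ≤ (gram ℝ r).det * c ^ Fintype.card {i // p i} := by positivity
    calc (gram ℝ r).det * c ^ Fintype.card {i // p i}
        ≤ ((gram ℝ r).det * c ^ Fintype.card {i // p i}) *
          (c ^ Fintype.card {i // ¬ p i} * (gram ℝ u).det) := le_mul_of_one_le_right hpos hle
      _ = _ := by ring

open Matrix in
theorem covol_bound [FiniteDimensional ℝ E] (L : Submodule ℤ E) (hL : IsLat L)
    (τ : E →ₗ[ℝ] E) (α : ℝ) (hα : 0 < α)
    (hs : ∀ x y : E, (inner ℝ (τ x) (τ y) : ℝ) = α * inner ℝ x y)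
    (hmap : L.map (τ.restrictScalars ℤ) = dualLat L) :
    0 ≤ covol L ∧ covol L ^ 2 * (Real.sqrt α) ^ finrank ℝ E ≤ 1 := by
  classical
  have hd := hL.1
  have hz : IsZLattice ℝ L := ⟨hL.2⟩
  have : Module.Free ℤ L := ZLattice.module_free ℝ L
  have : Module.Finite ℤ L := ZLattice.module_finite ℝ L
  let β := Module.Free.chooseBasis ℤ L
  set ι := Module.Free.ChooseBasisIndex ℤ L
  let βR : Basis ι ℝ E := β.ofZLatticeBasis ℝ L
  have hβR : ∀ i, βR i = β i := fun i => by simp [βR]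
  let w : ι → E := fun i => (β i : E)
  have hwli : LinearIndependent ℝ w := by
    have h1 : w = βR := by ext i; simp [hβR, w]
    rw [h1]; exact βR.linearIndependent
  have hcov : covol L = Real.sqrt (gram ℝ w).det := covol_eq_s8 _ β
  set G := gram ℝ w with hG
  have hGpos : 0 < G.det := (posDef_gram_of_linearIndependent hwli).det_pos
  have hGu : IsUnit G.det := hGpos.ne'.isUnit
  let ws : ι → E := fun i => ∑ j, G⁻¹ i j • w j
  have hws : ∀ i j, (inner ℝ (w j) (ws i) : ℝ) = (1 : Matrix ι ι ℝ) i j := by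
    intro i j
    rw [← Matrix.nonsing_inv_mul G hGu, Matrix.mul_apply]
    simp only [ws, inner_sum, real_inner_smul_right]
    refine Finset.sum_congr rfl fun l _ => ?_
    rw [hG, gram_apply, real_inner_comm]
  have hwsd : ∀ i, ws i ∈ L.map (τ.restrictScalars ℤ) := by
    intro i
    rw [hmap]
    intro x hx
    have h1 := congrArg (fun t : L => (t : E)) (β.sum_repr ⟨x, hx⟩)
    simp only [Submodule.coe_sum, Submodule.coe_smul] at h1
    refine ⟨β.repr ⟨x, hx⟩ i, ?_⟩
    refine (congrArg (fun t => (inner ℝ t (ws i) : ℝ)) h1.symm).trans ?_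
    simp only [sum_inner]
    rw [Finset.sum_eq_single i]
    · rw [← Int.cast_smul_eq_zsmul ℝ, real_inner_smul_left, hws i i]; simp
    · intro j _ hj
      rw [← Int.cast_smul_eq_zsmul ℝ, real_inner_smul_left, hws i j]
      simp [Matrix.one_apply, hj.symm]
    · simp
  choose x hxL hx using hwsd
  let U : Matrix ι ι ℤ := fun i j => β.repr ⟨x i, hxL i⟩ j
  have hxU : ∀ i, x i = ∑ j, (U.map (Int.cast : ℤ → ℝ)) i j • w j := by
    intro i
    have h1 := congrArg (fun t : L => (t : E)) (β.sum_repr ⟨x i, hxL i⟩)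
    simp only [Submodule.coe_sum, Submodule.coe_smul] at h1
    refine h1.symm.trans (Finset.sum_congr rfl fun j _ => ?_)
    rw [Matrix.map_apply, Int.cast_smul_eq_zsmul]
  have hg1 : gram ℝ ws = G⁻¹ * G * (G⁻¹)ᵀ := gram_transform G⁻¹ w ws fun _ => rfl
  have hg2 : gram ℝ ws = α • gram ℝ x := by
    ext i j
    rw [Matrix.smul_apply, gram_apply, gram_apply, ← hx, ← hx]
    exact hs _ _
  have hdU : (U.map (Int.cast : ℤ → ℝ)).det = (U.det : ℝ) :=
    ((Int.castRingHom ℝ).map_det _).symm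
  have hdet := congrArg Matrix.det (hg1.symm.trans hg2)
  rw [gram_transform _ _ _ hxU, Matrix.nonsing_inv_mul G hGu, one_mul, Matrix.det_transpose,
    Matrix.det_smul, Matrix.det_mul, Matrix.det_mul, Matrix.det_transpose, hdU,
    Matrix.det_nonsing_inv, Ring.inverse_eq_inv', ← hG] at hdet
  have hfr : finrank ℝ E = Fintype.card ι := finrank_eq_card_basis βR
  have hUne : U.det ≠ 0 := by
    intro h0
    rw [h0] at hdet
    simp at hdet
    exact hGpos.ne' hdet
  have hU1 : (1 : ℝ) ≤ (U.det : ℝ) ^ 2 := by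
    have : (1 : ℤ) ≤ U.det ^ 2 := by
      have := sq_pos_of_ne_zero hUne
      omega
    exact_mod_cast this
  refine ⟨hcov ▸ Real.sqrt_nonneg _, ?_⟩
  rw [hcov, Real.sq_sqrt hGpos.le, hfr]
  have h5 : (G.det * Real.sqrt α ^ Fintype.card ι) ^ 2 * (U.det : ℝ) ^ 2 = 1 := by
    have h6 : (Real.sqrt α ^ Fintype.card ι) ^ 2 = α ^ Fintype.card ι := by
      rw [← pow_mul, mul_comm, pow_mul, Real.sq_sqrt hα.le]
    rw [mul_pow, h6]
    have h7 : G.det⁻¹ * G.det = 1 := inv_mul_cancel₀ hGpos.ne'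
    rw [hdet] at h7
    linear_combination h7
  have h8 : (G.det * Real.sqrt α ^ Fintype.card ι) ^ 2 ≤ 1 := by
    rw [← h5]
    exact le_mul_of_one_le_right (sq_nonneg _) hU1
  exact (sq_le_one_iff₀ (by positivity)).1 h8

theorem isotropic_half [FiniteDimensional ℝ E] {n : ℕ} (v : Basis (Fin n) ℝ E)
    (τ : E →ₗ[ℝ] E) (hv : ∀ i j, i ≠ j → bform τ (v i) (v j) = 0)
    (F : Submodule ℝ E) (hF : ∀ x ∈ F, bform τ x x = 0) (q : Fin n → Prop) [DecidablePred q]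
    (ε : ℝ) (hq : ∀ i, q i → 0 < ε * bform τ (v i) (v i)) :
    finrank ℝ F + (Finset.univ.filter q).card ≤ finrank ℝ E := by
  let r : {i // q i} → E := fun i => v i
  have hr : LinearIndependent ℝ r := v.linearIndependent.comp _ Subtype.val_injective
  have h1 : finrank ℝ (Submodule.span ℝ (Set.range r)) = (Finset.univ.filter q).card := by
    rw [finrank_span_eq_card hr, Fintype.card_subtype]
  rw [← h1]
  refine Submodule.finrank_add_finrank_le_of_disjoint ?_
  rw [Submodule.disjoint_def]
  intro x hxF hxP
  obtain ⟨c, rfl⟩ := (Submodule.mem_span_range_iff_exists_fun ℝ).1 hxP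
  have h2 := hF _ hxF
  have h3 : bform τ (∑ i, c i • r i) (∑ i, c i • r i) =
      ∑ i : {i // q i}, c i ^ 2 * bform τ (v i) (v i) := by
    simp only [bform, map_sum, sum_inner, inner_sum, map_smul, real_inner_smul_left,
      real_inner_smul_right]
    refine Finset.sum_congr rfl fun i _ => ?_
    rw [Finset.sum_eq_single i]
    · simp only [r]; ring
    · intro j _ hj
      have := hv j i (fun h => hj (Subtype.ext h))
      simp only [bform] at this
      simp only [r]
      rw [this]; ring
    · simp
  rw [h3] at h2
  have h4 : ∑ i : {i // q i}, c i ^ 2 * (ε * bform τ (v i) (v i)) = 0 := by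
    rw [← mul_zero ε, ← h2, Finset.mul_sum]
    exact Finset.sum_congr rfl fun i _ => by ring
  rw [Finset.sum_eq_zero_iff_of_nonneg
    (fun (i : {i // q i}) _ => mul_nonneg (sq_nonneg (c i)) (hq i i.2).le)] at h4
  refine Finset.sum_eq_zero fun i _ => ?_
  have h5 := h4 i (Finset.mem_univ _)
  have : c i = 0 := by
    rcases mul_eq_zero.1 h5 with h | h
    · exact pow_eq_zero_iff (two_ne_zero) |>.1 h
    · exact absurd h (hq i i.2).ne'
  rw [this, zero_smul]

theorem isotropic_bound [FiniteDimensional ℝ E] (τ : E →ₗ[ℝ] E)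
    (hinj : ∀ x, τ x = 0 → x = 0) (s : ℤ) (hs : HasSignature (bform τ) s)
    (F : Submodule ℝ E) (hF : ∀ x ∈ F, bform τ x x = 0) :
    2 * (finrank ℝ F : ℤ) + |s| ≤ finrank ℝ E := by
  classical
  obtain ⟨n, v, hv, rfl⟩ := hs
  have hn : finrank ℝ E = n := by simpa using finrank_eq_card_basis v
  have hne : ∀ i, bform τ (v i) (v i) ≠ 0 := by
    intro i h0
    apply v.ne_zero i
    apply hinj
    have h1 : ∀ y, inner ℝ (τ (v i)) y = (0 : ℝ) := by
      intro y
      rw [← v.sum_repr y, inner_sum]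
      refine Finset.sum_eq_zero fun j _ => ?_
      rw [real_inner_smul_right]
      by_cases hij : i = j
      · subst hij
        have : (inner ℝ (τ (v i)) (v i) : ℝ) = 0 := h0
        rw [this, mul_zero]
      · have : (inner ℝ (τ (v i)) (v j) : ℝ) = 0 := hv i j hij
        rw [this, mul_zero]
    exact inner_self_eq_zero.1 (h1 _)
  have hp := isotropic_half v τ hv F hF (fun i => 0 < bform τ (v i) (v i)) 1
    (fun i hi => by simpa using hi)
  have hq := isotropic_half v τ hv F hF (fun i => bform τ (v i) (v i) < 0) (-1)
    (fun i hi => by simpa using hi)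
  have hsum : (Finset.univ.filter fun i => 0 < bform τ (v i) (v i)).card +
      (Finset.univ.filter fun i => bform τ (v i) (v i) < 0).card = n := by
    have h1 := Finset.card_filter_add_card_filter_not (s := (Finset.univ : Finset (Fin n)))
      (fun i => 0 < bform τ (v i) (v i))
    rw [Finset.card_univ, Fintype.card_fin] at h1
    refine Eq.trans ?_ h1
    congr 2
    ext i
    simp only [Finset.mem_filter, Finset.mem_univ, true_and, not_lt]
    exact ⟨le_of_lt, fun h => lt_of_le_of_ne h (hne i)⟩
  rcases abs_cases ((((Finset.univ.filter fun i => 0 < bform τ (v i) (v i)).card : ℤ) -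
        ((Finset.univ.filter fun i => bform τ (v i) (v i) < 0).card : ℤ))) with ⟨h, _⟩ | ⟨h, _⟩ <;>
    rw [h] <;> omega

theorem redH_pow [FiniteDimensional ℝ E] (M : Submodule ℤ E) (h0 : 0 ≤ covol M)
    (hn : finrank ℝ E ≠ 0) (c : ℝ) :
    (redH M ^ 2 * c) ^ finrank ℝ E = covol M ^ 2 * c ^ finrank ℝ E := by
  have : redH M ^ finrank ℝ E = covol M := by
    rw [redH, Real.rpow_inv_natCast_pow h0 hn]
  rw [mul_pow, ← pow_mul, mul_comm 2, pow_mul, this]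

/-- Main consequence: for a subspace violating semistability. -/
theorem violating [FiniteDimensional ℝ E] (L : Submodule ℤ E) (hL : IsLat L)
    (τ : E →ₗ[ℝ] E) (hiso : IsIsodual L τ)
    (hsym : ∀ x y, bform τ x y = bform τ y x)
    (F : Submodule ℝ E) (hF0 : F ≠ ⊥) (hF : IsRational L F) (hlt : Hr L F < redH L) :
    ∃ D : Submodule ℝ E, D ≤ F ∧ D ≠ ⊥ ∧ IsRational L D ∧
      (∀ x ∈ D, bform τ x x = 0) ∧ (Hr L F ≤ Hr L D → D = F) := by
  obtain ⟨⟨α, hα, hs⟩, hmap⟩ := hiso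
  have hτ : τ.IsSymmetric := by
    intro x y
    have := hsym x y
    simp only [bform] at this
    rw [this, real_inner_comm]
  set c := Real.sqrt α with hcdef
  have hc0 : 0 < c := Real.sqrt_pos.2 hα
  have hc : ∀ x, |inner ℝ (τ x) x| ≤ c * ‖x‖ ^ 2 := by
    intro x
    have h1 := abs_real_inner_le_norm (τ x) x
    have h2 : ‖τ x‖ = c * ‖x‖ := by
      rw [← sq_eq_sq₀ (norm_nonneg _) (by positivity), mul_pow, Real.sq_sqrt hα.le,
        ← real_inner_self_eq_norm_sq, ← real_inner_self_eq_norm_sq, hs]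
    rw [h2] at h1
    linarith
  have hint : ∀ x ∈ L, ∀ y ∈ L, ∃ n : ℤ, (inner ℝ (τ x) y : ℝ) = n := by
    intro x hx y hy
    have h1 : τ x ∈ dualLat L := by
      rw [← hmap]; exact ⟨x, hx, rfl⟩
    obtain ⟨n, hn⟩ := h1 y hy
    exact ⟨n, by rw [real_inner_comm, hn]⟩
  obtain ⟨D, hDF, hDr, hDrad, hcD, hcF, hle⟩ := key L hL τ hτ c hc hc0 hint F hF
  obtain ⟨hcL0, hcL⟩ := covol_bound L hL τ α hα hs hmap
  have hdF : 0 < finrank ℝ F := by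
    rw [Module.finrank_pos_iff, Submodule.nontrivial_iff_ne_bot]; exact hF0
  have hdE : finrank ℝ E ≠ 0 := (hdF.trans_le F.finrank_le).ne'
  have hHF : 0 < Hr L F := Real.rpow_pos_of_pos hcF _
  have hL1 : redH L ^ 2 * c ≤ 1 := by
    rw [← hcdef, ← redH_pow L hcL0 hdE] at hcL
    exact (pow_le_one_iff_of_nonneg (by positivity) hdE).1 hcL
  have hF1 : Hr L F ^ 2 * c < 1 := lt_of_lt_of_le (by gcongr) hL1
  have hψF : 0 < Hr L F ^ 2 * c := by positivity
  have hFp : (Hr L F ^ 2 * c) ^ finrank ℝ F = covol (latIn L F) ^ 2 * c ^ finrank ℝ F :=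
    redH_pow (latIn L F) hcF.le hdF.ne' c
  rw [← hFp] at hle
  have hD0 : D ≠ ⊥ := by
    rintro rfl
    have h1 : covol (latIn L (⊥ : Submodule ℝ E)) = 1 := by
      have : Subsingleton (latIn L (⊥ : Submodule ℝ E)) := inferInstance
      rw [covol_eq_s8 _ (Basis.empty (latIn L (⊥ : Submodule ℝ E)) : Basis (Fin 0) ℤ _)]
      simp
    rw [h1] at hle
    simp only [finrank_bot, pow_zero, one_pow, mul_one] at hle
    exact absurd hle (not_le.2 (pow_lt_one₀ hψF.le hF1 hdF.ne'))
  refine ⟨D, hDF, hD0, hDr, fun x hx => hDrad x hx x (hDF hx), fun hH => ?_⟩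
  have hdD : 0 < finrank ℝ D := by
    rw [Module.finrank_pos_iff, Submodule.nontrivial_iff_ne_bot]; exact hD0
  have hDp : (Hr L D ^ 2 * c) ^ finrank ℝ D = covol (latIn L D) ^ 2 * c ^ finrank ℝ D :=
    redH_pow (latIn L D) hcD.le hdD.ne' c
  rw [← hDp] at hle
  have h2 : (Hr L F ^ 2 * c) ^ finrank ℝ D ≤ (Hr L F ^ 2 * c) ^ finrank ℝ F :=
    le_trans (by gcongr) hle
  have h3 : finrank ℝ F ≤ finrank ℝ D := (pow_le_pow_iff_right_of_lt_one₀ hψF hF1).1 h2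
  exact Submodule.eq_of_le_of_finrank_le hDF h3

theorem covol_nonneg (M : Submodule ℤ E) : 0 ≤ covol M := by
  unfold covol
  split_ifs
  · exact Real.sqrt_nonneg _
  · exact le_rfl

theorem Hmin_le (L : Submodule ℤ E) (F : Submodule ℝ E) (h0 : F ≠ ⊥) (hF : IsRational L F) :
    Hmin L ≤ Hr L F := by
  refine csInf_le ⟨0, ?_⟩ ⟨F, h0, hF, rfl⟩
  rintro _ ⟨F', _, _, rfl⟩
  exact Real.rpow_nonneg (covol_nonneg _) _

/-- For an orthogonal isodual Euclidean lattice `(E, L, τ)` with `b_τ` of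
signature `s`: if `(E, L)` is unstable then the destabilizing subspace has dimension at most
`(dim E - |s|)/2`; in particular if `b_τ` is definite then `(E, L)` is semistable. -/
theorem statement8 {E : Type*} [NormedAddCommGroup E] [InnerProductSpace ℝ E]
    [FiniteDimensional ℝ E] (L : Submodule ℤ E) (hL : IsLat L)
    (τ : E →ₗ[ℝ] E) (hiso : IsIsodual L τ)
    (hsym : ∀ x y, bform τ x y = bform τ y x)
    (s : ℤ) (hs : HasSignature (bform τ) s) :
    (¬ Semistable L → ∀ E₁ : Submodule ℝ E, IsDestabilizing L E₁ →
      (finrank ℝ E₁ : ℝ) ≤ ((finrank ℝ E : ℝ) - |(s : ℝ)|) / 2) ∧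
    (s.natAbs = finrank ℝ E → Semistable L) := by
  have hinj : ∀ x, τ x = 0 → x = 0 := by
    intro x hx
    obtain ⟨⟨α, hα, h⟩, _⟩ := hiso
    have h1 := h x x
    rw [hx, inner_zero_left] at h1
    exact inner_self_eq_zero.1 ((mul_eq_zero.1 h1.symm).resolve_left hα.ne')
  constructor
  · intro hns E₁ hE₁
    obtain ⟨h0, hr, hmin, _⟩ := hE₁
    unfold Semistable at hns
    push Not at hns
    obtain ⟨F, hF0, hF, hlt⟩ := hns
    have hlt' : Hr L E₁ < redH L := by
      rw [hmin]; exact (Hmin_le L F hF0 hF).trans_lt hlt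
    obtain ⟨D, hDE, hD0, hDr, hDi, hDeq⟩ := violating L hL τ hiso hsym E₁ h0 hr hlt'
    have hD : D = E₁ := hDeq (by rw [hmin]; exact Hmin_le L D hD0 hDr)
    subst hD
    have h1 := isotropic_bound τ hinj s hs D hDi
    have h2 : 2 * (finrank ℝ D : ℝ) + |(s : ℝ)| ≤ finrank ℝ E := by exact_mod_cast h1
    linarith
  · intro hdef F hF0 hF
    by_contra hlt
    obtain ⟨D, hDE, hD0, hDr, hDi, -⟩ := violating L hL τ hiso hsym F hF0 hF (not_le.1 hlt)
    have h1 := isotropic_bound τ hinj s hs D hDi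
    have hdD : 0 < finrank ℝ D := by
      rw [Module.finrank_pos_iff, Submodule.nontrivial_iff_ne_bot]; exact hD0
    rw [Int.abs_eq_natAbs] at h1
    omega

end EucLat
end
end
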